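/- arXiv:2604.03815 — 9 statements merged into one kernel-verified Lean document; each statement's English description precedes it below -/
import Mathlib

section
/- Under the S-SEG-WL setup with a strongly regular structural encoding scheme on the two graphs and a coloring model satisfying conditions C1–C2, for every iteration l ∈ ℕ, every v ∈ V₁ and every w ∈ V₂: if c₁ l v = c₂ l w then d₁ l v = d₂ l w. -/
/-- **S-SEG-WL upper bound, node-embedding invariant (IH.1).**
Under a strongly regular structural encoding scheme on two graphs and a coloring
model satisfying conditions C1–C2, for every iteration `l`, every `v ∈ V₁` and
`w ∈ V₂`: if the S-SEG-WL colors agree, `c₁ l v = c₂ l w`, then the model node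
embeddings agree, `d₁ l v = d₂ l w`. -/
theorem seg_wl_node_embedding_invariant
    {V₁ V₂ C : Type*} [Fintype V₁] [Fintype V₂] [Nonempty V₁] [Nonempty V₂]
    {d : ℕ} (X₁ : V₁ → (Fin d → ℝ)) (X₂ : V₂ → (Fin d → ℝ))
    -- structural encoding scheme
    (fA₁ : V₁ → C) (fA₂ : V₂ → C)
    (fR₁ : V₁ → V₁ → C) (fR₂ : V₂ → V₂ → C)
    -- S-SEG-WL colorings
    (Φ₀ : (Fin d → ℝ) × C → C) (Φ : Multiset (C × C) → C)
    (hΦ₀ : Function.Injective Φ₀) (hΦ : Function.Injective Φ)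
    (c₁ : ℕ → V₁ → C) (c₂ : ℕ → V₂ → C)
    (hc₁0 : ∀ v, c₁ 0 v = Φ₀ (X₁ v, fA₁ v))
    (hc₂0 : ∀ w, c₂ 0 w = Φ₀ (X₂ w, fA₂ w))
    (hc₁s : ∀ l v, c₁ (l + 1) v =
      Φ ((Finset.univ : Finset V₁).val.map fun r => (c₁ l r, fR₁ v r)))
    (hc₂s : ∀ l w, c₂ (l + 1) w =
      Φ ((Finset.univ : Finset V₂).val.map fun s => (c₂ l s, fR₂ w s)))
    -- strong regularity
    (ξ : C → Bool)
    (hξ₁ : ∀ u v : V₁, ξ (fR₁ v u) = true ↔ u = v)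
    (hξ₂ : ∀ u v : V₂, ξ (fR₂ v u) = true ↔ u = v)
    -- coloring model satisfying C1–C2
    (φ : (Fin d → ℝ) × C → C) (ψ : C → C)
    (σ : Multiset (C × C × C) → C) (τ : C × C × C × C → C)
    (d₁ : ℕ → V₁ → C) (d₂ : ℕ → V₂ → C)
    (e₁ : ℕ → V₁ → V₁ → C) (e₂ : ℕ → V₂ → V₂ → C)
    (hd₁0 : ∀ v, d₁ 0 v = φ (X₁ v, fA₁ v))
    (hd₂0 : ∀ w, d₂ 0 w = φ (X₂ w, fA₂ w))
    (he₁0 : ∀ r v, e₁ 0 r v = ψ (fR₁ v r))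
    (he₂0 : ∀ s w, e₂ 0 s w = ψ (fR₂ w s))
    (hd₁s : ∀ l v, d₁ (l + 1) v =
      σ ((Finset.univ : Finset V₁).val.map fun r => (d₁ l r, e₁ l r v, fR₁ v r)))
    (hd₂s : ∀ l w, d₂ (l + 1) w =
      σ ((Finset.univ : Finset V₂).val.map fun s => (d₂ l s, e₂ l s w, fR₂ w s)))
    (he₁s : ∀ l r v, e₁ (l + 1) r v = τ (e₁ l r v, d₁ l r, d₁ l v, fR₁ v r))
    (he₂s : ∀ l s w, e₂ (l + 1) s w = τ (e₂ l s w, d₂ l s, d₂ l w, fR₂ w s)) :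
    ∀ (l : ℕ) (v : V₁) (w : V₂), c₁ l v = c₂ l w → d₁ l v = d₂ l w := by
  have ms : ∀ l v w, c₁ (l + 1) v = c₂ (l + 1) w →
      Multiset.Rel (fun r s => c₁ l r = c₂ l s ∧ fR₁ v r = fR₂ w s)
        (Finset.univ : Finset V₁).val (Finset.univ : Finset V₂).val := by
    intro l v w h
    rw [hc₁s, hc₂s] at h
    have h2 := Multiset.rel_eq.2 (hΦ h)
    rw [Multiset.rel_map] at h2
    exact h2.mono fun a _ b _ hab => Prod.ext_iff.1 hab
  have down : ∀ l v w, c₁ (l + 1) v = c₂ (l + 1) w → c₁ l v = c₂ l w := by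
    intro l v w h
    obtain ⟨s, -, h1, h2⟩ := Multiset.exists_mem_of_rel_of_mem (ms l v w h)
      (Finset.mem_univ_val v)
    have h3 : ξ (fR₂ w s) = true := by rw [← h2]; exact (hξ₁ v v).2 rfl
    rw [(hξ₂ s w).1 h3] at h1
    exact h1
  have key : ∀ l, (∀ v w, c₁ l v = c₂ l w → d₁ l v = d₂ l w) ∧
      (∀ v w r s, c₁ l v = c₂ l w → c₁ l r = c₂ l s → fR₁ v r = fR₂ w s →
        e₁ l r v = e₂ l s w) := by
    intro l
    induction l with
    | zero =>
      refine ⟨fun v w h => ?_, fun v w r s _ _ h => ?_⟩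
      · rw [hc₁0, hc₂0] at h
        rw [hd₁0, hd₂0, hΦ₀ h]
      · rw [he₁0, he₂0, h]
    | succ l ih =>
      obtain ⟨ihd, ihe⟩ := ih
      refine ⟨fun v w h => ?_, fun v w r s hv hr h => ?_⟩
      · rw [hd₁s, hd₂s]
        congr 1
        rw [← Multiset.rel_eq, Multiset.rel_map]
        refine (ms l v w h).mono fun r _ s _ hrs => ?_
        rw [ihd r s hrs.1, ihe v w r s (down l v w h) hrs.1 hrs.2, hrs.2]
      · have hv' := down l v w hv
        have hr' := down l r s hr
        rw [he₁s, he₂s, ihe v w r s hv' hr' h, ihd r s hr', ihd v w hv', h]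
  exact fun l => (key l).1
end

section
/- Under the S-SEG-WL setup with a strongly regular structural encoding scheme on the two graphs and a coloring model satisfying conditions C1–C2, for every iteration l ∈ ℕ, all r, v ∈ V₁ and all s, w ∈ V₂: if c₁ l r = c₂ l s, fR₁ v r = fR₂ w s, and c₁ l v = c₂ l w, then e₁ l r v = e₂ l s w. -/
/-- **S-SEG-WL upper bound, node-embedding invariant (IH.1).**
Under a strongly regular structural encoding scheme on two graphs and a coloring
model satisfying conditions C1–C2, for every iteration `l`, every `v ∈ V₁` and
`w ∈ V₂`: if the S-SEG-WL colors agree, `c₁ l v = c₂ l w`, then the model node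
embeddings agree, `d₁ l v = d₂ l w`. -/
theorem seg_wl_edge_embedding_invariant
    {V₁ V₂ C : Type*} [Fintype V₁] [Fintype V₂] [Nonempty V₁] [Nonempty V₂]
    {d : ℕ} (X₁ : V₁ → (Fin d → ℝ)) (X₂ : V₂ → (Fin d → ℝ))
    -- structural encoding scheme
    (fA₁ : V₁ → C) (fA₂ : V₂ → C)
    (fR₁ : V₁ → V₁ → C) (fR₂ : V₂ → V₂ → C)
    -- S-SEG-WL colorings
    (Φ₀ : (Fin d → ℝ) × C → C) (Φ : Multiset (C × C) → C)
    (hΦ₀ : Function.Injective Φ₀) (hΦ : Function.Injective Φ)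
    (c₁ : ℕ → V₁ → C) (c₂ : ℕ → V₂ → C)
    (hc₁0 : ∀ v, c₁ 0 v = Φ₀ (X₁ v, fA₁ v))
    (hc₂0 : ∀ w, c₂ 0 w = Φ₀ (X₂ w, fA₂ w))
    (hc₁s : ∀ l v, c₁ (l + 1) v =
      Φ ((Finset.univ : Finset V₁).val.map fun r => (c₁ l r, fR₁ v r)))
    (hc₂s : ∀ l w, c₂ (l + 1) w =
      Φ ((Finset.univ : Finset V₂).val.map fun s => (c₂ l s, fR₂ w s)))
    -- strong regularity
    (ξ : C → Bool)
    (hξ₁ : ∀ u v : V₁, ξ (fR₁ v u) = true ↔ u = v)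
    (hξ₂ : ∀ u v : V₂, ξ (fR₂ v u) = true ↔ u = v)
    -- coloring model satisfying C1–C2
    (φ : (Fin d → ℝ) × C → C) (ψ : C → C)
    (σ : Multiset (C × C × C) → C) (τ : C × C × C × C → C)
    (d₁ : ℕ → V₁ → C) (d₂ : ℕ → V₂ → C)
    (e₁ : ℕ → V₁ → V₁ → C) (e₂ : ℕ → V₂ → V₂ → C)
    (hd₁0 : ∀ v, d₁ 0 v = φ (X₁ v, fA₁ v))
    (hd₂0 : ∀ w, d₂ 0 w = φ (X₂ w, fA₂ w))
    (he₁0 : ∀ r v, e₁ 0 r v = ψ (fR₁ v r))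
    (he₂0 : ∀ s w, e₂ 0 s w = ψ (fR₂ w s))
    (hd₁s : ∀ l v, d₁ (l + 1) v =
      σ ((Finset.univ : Finset V₁).val.map fun r => (d₁ l r, e₁ l r v, fR₁ v r)))
    (hd₂s : ∀ l w, d₂ (l + 1) w =
      σ ((Finset.univ : Finset V₂).val.map fun s => (d₂ l s, e₂ l s w, fR₂ w s)))
    (he₁s : ∀ l r v, e₁ (l + 1) r v = τ (e₁ l r v, d₁ l r, d₁ l v, fR₁ v r))
    (he₂s : ∀ l s w, e₂ (l + 1) s w = τ (e₂ l s w, d₂ l s, d₂ l w, fR₂ w s)) :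
    ∀ (l : ℕ) (r v : V₁) (s w : V₂),
      c₁ l r = c₂ l s → fR₁ v r = fR₂ w s → c₁ l v = c₂ l w →
        e₁ l r v = e₂ l s w := by
  have tr : ∀ {α β : Type _} (f : V₁ → α) (g : V₂ → α) (F : V₁ → β) (G : V₂ → β),
      (Finset.univ : Finset V₁).val.map f = (Finset.univ : Finset V₂).val.map g →
      (∀ r s, f r = g s → F r = G s) →
      (Finset.univ : Finset V₁).val.map F = (Finset.univ : Finset V₂).val.map G := by
    intro α β f g F G h hFG
    rw [← Multiset.rel_eq, Multiset.rel_map] at h ⊢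
    exact h.mono fun r _ s _ hrs => hFG r s hrs
  have ref : ∀ l v w, c₁ (l + 1) v = c₂ (l + 1) w → c₁ l v = c₂ l w := by
    intro l v w h
    rw [hc₁s, hc₂s] at h
    have h := hΦ h
    have hm : (c₁ l v, fR₁ v v) ∈
        (Finset.univ : Finset V₁).val.map fun r => (c₁ l r, fR₁ v r) :=
      Multiset.mem_map.2 ⟨v, Finset.mem_univ v, rfl⟩
    rw [h] at hm
    obtain ⟨s, -, hs⟩ := Multiset.mem_map.1 hm
    obtain ⟨h1, h2⟩ := Prod.mk.inj hs
    have : s = w := (hξ₂ s w).1 (by rw [h2]; exact (hξ₁ v v).2 rfl)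
    rw [← h1, this]
  have main : ∀ l, (∀ v w, c₁ l v = c₂ l w → d₁ l v = d₂ l w) ∧
      (∀ (r v : V₁) (s w : V₂), c₁ l r = c₂ l s → fR₁ v r = fR₂ w s → c₁ l v = c₂ l w →
        e₁ l r v = e₂ l s w) := by
    intro l
    induction l with
    | zero =>
      refine ⟨fun v w h => ?_, fun r v s w _ h _ => by rw [he₁0, he₂0, h]⟩
      rw [hc₁0, hc₂0] at h
      rw [hd₁0, hd₂0, hΦ₀ h]
    | succ l ih =>
      obtain ⟨ihd, ihe⟩ := ih
      refine ⟨fun v w h => ?_, fun r v s w hr hf hv => ?_⟩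
      · have hl := ref l v w h
        rw [hc₁s, hc₂s] at h
        rw [hd₁s, hd₂s]
        refine congrArg σ (tr _ _ _ _ (hΦ h) ?_)
        intro r s hrs
        obtain ⟨h1, h2⟩ := Prod.mk.inj hrs
        simp only [ihd r s h1, ihe r v s w h1 h2 hl, h2]
      · have hr := ref l r s hr
        have hv := ref l v w hv
        rw [he₁s, he₂s, ihe r v s w hr hf hv, ihd r s hr, ihd v w hv, hf]
  exact fun l => (main l).2
end

section
/- Under the S-SEG-WL setup with a strongly regular structural encoding scheme on the two graphs and a coloring model satisfying conditions C1–C2, for every iteration l ∈ ℕ: if the multiset of S-SEG-WL colors {c₁ l v : v ∈ V₁} equals the multiset {c₂ l w : w ∈ V₂}, then the multiset of model node embeddings {d₁ l v : v ∈ V₁} equals the multiset {d₂ l w : w ∈ V₂}. Equivalently, any two graphs that the model distinguishes at iteration l are also distinguished by the S-SEG-WL test at iteration l. -/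
/-- **S-SEG-WL upper bound, node-embedding invariant (IH.1).**
Under a strongly regular structural encoding scheme on two graphs and a coloring
model satisfying conditions C1–C2, for every iteration `l`, every `v ∈ V₁` and
`w ∈ V₂`: if the S-SEG-WL colors agree, `c₁ l v = c₂ l w`, then the model node
embeddings agree, `d₁ l v = d₂ l w`. -/
theorem seg_wl_upper_bounds_model
    {V₁ V₂ C : Type*} [Fintype V₁] [Fintype V₂] [Nonempty V₁] [Nonempty V₂]
    {d : ℕ} (X₁ : V₁ → (Fin d → ℝ)) (X₂ : V₂ → (Fin d → ℝ))
    -- structural encoding scheme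
    (fA₁ : V₁ → C) (fA₂ : V₂ → C)
    (fR₁ : V₁ → V₁ → C) (fR₂ : V₂ → V₂ → C)
    -- S-SEG-WL colorings
    (Φ₀ : (Fin d → ℝ) × C → C) (Φ : Multiset (C × C) → C)
    (hΦ₀ : Function.Injective Φ₀) (hΦ : Function.Injective Φ)
    (c₁ : ℕ → V₁ → C) (c₂ : ℕ → V₂ → C)
    (hc₁0 : ∀ v, c₁ 0 v = Φ₀ (X₁ v, fA₁ v))
    (hc₂0 : ∀ w, c₂ 0 w = Φ₀ (X₂ w, fA₂ w))
    (hc₁s : ∀ l v, c₁ (l + 1) v =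
      Φ ((Finset.univ : Finset V₁).val.map fun r => (c₁ l r, fR₁ v r)))
    (hc₂s : ∀ l w, c₂ (l + 1) w =
      Φ ((Finset.univ : Finset V₂).val.map fun s => (c₂ l s, fR₂ w s)))
    -- strong regularity
    (ξ : C → Bool)
    (hξ₁ : ∀ u v : V₁, ξ (fR₁ v u) = true ↔ u = v)
    (hξ₂ : ∀ u v : V₂, ξ (fR₂ v u) = true ↔ u = v)
    -- coloring model satisfying C1–C2
    (φ : (Fin d → ℝ) × C → C) (ψ : C → C)
    (σ : Multiset (C × C × C) → C) (τ : C × C × C × C → C)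
    (d₁ : ℕ → V₁ → C) (d₂ : ℕ → V₂ → C)
    (e₁ : ℕ → V₁ → V₁ → C) (e₂ : ℕ → V₂ → V₂ → C)
    (hd₁0 : ∀ v, d₁ 0 v = φ (X₁ v, fA₁ v))
    (hd₂0 : ∀ w, d₂ 0 w = φ (X₂ w, fA₂ w))
    (he₁0 : ∀ r v, e₁ 0 r v = ψ (fR₁ v r))
    (he₂0 : ∀ s w, e₂ 0 s w = ψ (fR₂ w s))
    (hd₁s : ∀ l v, d₁ (l + 1) v =
      σ ((Finset.univ : Finset V₁).val.map fun r => (d₁ l r, e₁ l r v, fR₁ v r)))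
    (hd₂s : ∀ l w, d₂ (l + 1) w =
      σ ((Finset.univ : Finset V₂).val.map fun s => (d₂ l s, e₂ l s w, fR₂ w s)))
    (he₁s : ∀ l r v, e₁ (l + 1) r v = τ (e₁ l r v, d₁ l r, d₁ l v, fR₁ v r))
    (he₂s : ∀ l s w, e₂ (l + 1) s w = τ (e₂ l s w, d₂ l s, d₂ l w, fR₂ w s)) :
    ∀ l : ℕ,
      (Finset.univ : Finset V₁).val.map (c₁ l) =
        (Finset.univ : Finset V₂).val.map (c₂ l) →
      (Finset.univ : Finset V₁).val.map (d₁ l) =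
        (Finset.univ : Finset V₂).val.map (d₂ l) := by
  have key : ∀ {β γ : Type _} (f : V₁ → β) (g : V₂ → β) (f' : V₁ → γ) (g' : V₂ → γ),
      (∀ a b, f a = g b → f' a = g' b) →
      (Finset.univ : Finset V₁).val.map f = (Finset.univ : Finset V₂).val.map g →
      (Finset.univ : Finset V₁).val.map f' = (Finset.univ : Finset V₂).val.map g' := by
    intro β γ f g f' g' h hm
    rw [← Multiset.rel_eq, Multiset.rel_map] at hm ⊢
    exact hm.mono fun a _ b _ hab => h a b hab
  have mono : ∀ l v w, c₁ (l + 1) v = c₂ (l + 1) w → c₁ l v = c₂ l w := by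
    intro l v w h
    rw [hc₁s, hc₂s] at h
    have h := hΦ h
    have hv : (c₁ l v, fR₁ v v) ∈
        (Finset.univ : Finset V₁).val.map fun r => (c₁ l r, fR₁ v r) :=
      Multiset.mem_map.2 ⟨v, Finset.mem_univ v, rfl⟩
    rw [h] at hv
    obtain ⟨s, -, hs⟩ := Multiset.mem_map.1 hv
    rw [Prod.mk.injEq] at hs
    have h1 : s = w := (hξ₂ s w).1 (by rw [hs.2]; exact (hξ₁ v v).2 rfl)
    rw [← hs.1, h1]
  have main : ∀ l, (∀ v w, c₁ l v = c₂ l w → d₁ l v = d₂ l w) ∧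
      (∀ r v s w, c₁ l v = c₂ l w → c₁ l r = c₂ l s → fR₁ v r = fR₂ w s →
        e₁ l r v = e₂ l s w) := by
    intro l
    induction l with
    | zero =>
      refine ⟨fun v w h => ?_, fun r v s w _ _ h => ?_⟩
      · rw [hc₁0, hc₂0] at h
        rw [hd₁0, hd₂0, hΦ₀ h]
      · rw [he₁0, he₂0, h]
    | succ l ih =>
      refine ⟨fun v w h => ?_, fun r v s w hv hr h => ?_⟩
      · have hvw := mono l v w h
        rw [hc₁s, hc₂s] at h
        rw [hd₁s, hd₂s]
        congr 1
        refine key _ _ _ _ ?_ (hΦ h)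
        intro a b hab
        rw [Prod.mk.injEq] at hab
        rw [ih.1 a b hab.1, ih.2 a v b w hvw hab.1 hab.2, hab.2]
      · have hv := mono l v w hv
        have hr := mono l r s hr
        rw [he₁s, he₂s, ih.1 v w hv, ih.1 r s hr, ih.2 r v s w hv hr h, h]
  intro l h
  exact key _ _ _ _ (main l).1 h
end

section
/- Under the S-SEG-WL setup with a strongly regular structural encoding scheme on the two graphs, the colorings refine across iterations even between the two graphs: for every l ∈ ℕ, every v ∈ V₁ and every w ∈ V₂, if c₁ (l+1) v = c₂ (l+1) w then c₁ l v = c₂ l w. -/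
/-- **S-SEG-WL colorings refine across iterations, even between two graphs.**
Under a strongly regular structural encoding scheme, if two nodes (possibly in
different graphs) get the same color at iteration `l + 1`, they already had the
same color at iteration `l`. -/
theorem seg_wl_coloring_refines
    {V₁ V₂ C : Type*} [Fintype V₁] [Fintype V₂] [Nonempty V₁] [Nonempty V₂]
    {d : ℕ} (X₁ : V₁ → (Fin d → ℝ)) (X₂ : V₂ → (Fin d → ℝ))
    -- structural encoding scheme
    (fA₁ : V₁ → C) (fA₂ : V₂ → C)
    (fR₁ : V₁ → V₁ → C) (fR₂ : V₂ → V₂ → C)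
    -- S-SEG-WL colorings
    (Φ₀ : (Fin d → ℝ) × C → C) (Φ : Multiset (C × C) → C)
    (hΦ₀ : Function.Injective Φ₀) (hΦ : Function.Injective Φ)
    (c₁ : ℕ → V₁ → C) (c₂ : ℕ → V₂ → C)
    (hc₁0 : ∀ v, c₁ 0 v = Φ₀ (X₁ v, fA₁ v))
    (hc₂0 : ∀ w, c₂ 0 w = Φ₀ (X₂ w, fA₂ w))
    (hc₁s : ∀ l v, c₁ (l + 1) v =
      Φ ((Finset.univ : Finset V₁).val.map fun r => (c₁ l r, fR₁ v r)))
    (hc₂s : ∀ l w, c₂ (l + 1) w =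
      Φ ((Finset.univ : Finset V₂).val.map fun s => (c₂ l s, fR₂ w s)))
    -- strong regularity
    (ξ : C → Bool)
    (hξ₁ : ∀ u v : V₁, ξ (fR₁ v u) = true ↔ u = v)
    (hξ₂ : ∀ u v : V₂, ξ (fR₂ v u) = true ↔ u = v) :
    ∀ (l : ℕ) (v : V₁) (w : V₂), c₁ (l + 1) v = c₂ (l + 1) w → c₁ l v = c₂ l w := by
  intro l v w h
  rw [hc₁s, hc₂s] at h
  have h' := hΦ h
  have hm : (c₁ l v, fR₁ v v) ∈
      (Finset.univ : Finset V₁).val.map fun r => (c₁ l r, fR₁ v r) :=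
    Multiset.mem_map.2 ⟨v, Finset.mem_univ v, rfl⟩
  rw [h'] at hm
  obtain ⟨s, -, hs⟩ := Multiset.mem_map.1 hm
  have h1 := congrArg Prod.fst hs
  have h2 : fR₂ w s = fR₁ v v := congrArg Prod.snd hs
  have hsw : s = w := (hξ₂ s w).1 (by rw [h2]; exact (hξ₁ v v).2 rfl)
  subst hsw
  exact h1.symm
end

section
/- Let S = (fA, fR) and S' = (fA', fR') be two structural encoding schemes on the same pair of graphs such that S' is a refinement of S, i.e. there are maps pA, pR : C → C with fAᵢ v = pA (fA'ᵢ v) and fRᵢ v u = pR (fR'ᵢ v u) for i ∈ {1,2} and all u, v ∈ Vᵢ. Let c denote the S-SEG-WL colorings (built from injective Φ₀, Φ) and c' the S'-SEG-WL colorings (built from injective Φ₀', Φ'). Then for every iteration t ∈ ℕ, every v ∈ V₁ and every w ∈ V₂: if c'₁ t v = c'₂ t w then c₁ t v = c₂ t w. -/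
/-- **Refined encoding schemes give (pointwise) more discriminative SEG-WL colorings.**
If `S' = (fA', fR')` refines `S = (fA, fR)` via maps `pA`, `pR`, then for every
iteration `t`, whenever the `S'`-SEG-WL colors of `v ∈ V₁` and `w ∈ V₂` agree,
so do their `S`-SEG-WL colors. -/
theorem seg_wl_refinement_pointwise
    {V₁ V₂ C : Type*} [Fintype V₁] [Fintype V₂] [Nonempty V₁] [Nonempty V₂]
    {d : ℕ} (X₁ : V₁ → (Fin d → ℝ)) (X₂ : V₂ → (Fin d → ℝ))
    -- scheme S
    (fA₁ : V₁ → C) (fA₂ : V₂ → C)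
    (fR₁ : V₁ → V₁ → C) (fR₂ : V₂ → V₂ → C)
    -- scheme S'
    (fA₁' : V₁ → C) (fA₂' : V₂ → C)
    (fR₁' : V₁ → V₁ → C) (fR₂' : V₂ → V₂ → C)
    -- S' refines S
    (pA pR : C → C)
    (hpA₁ : ∀ v, fA₁ v = pA (fA₁' v)) (hpA₂ : ∀ w, fA₂ w = pA (fA₂' w))
    (hpR₁ : ∀ v u, fR₁ v u = pR (fR₁' v u)) (hpR₂ : ∀ w u, fR₂ w u = pR (fR₂' w u))
    -- S-SEG-WL colorings
    (Φ₀ : (Fin d → ℝ) × C → C) (Φ : Multiset (C × C) → C)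
    (hΦ₀ : Function.Injective Φ₀) (hΦ : Function.Injective Φ)
    (c₁ : ℕ → V₁ → C) (c₂ : ℕ → V₂ → C)
    (hc₁0 : ∀ v, c₁ 0 v = Φ₀ (X₁ v, fA₁ v))
    (hc₂0 : ∀ w, c₂ 0 w = Φ₀ (X₂ w, fA₂ w))
    (hc₁s : ∀ l v, c₁ (l + 1) v =
      Φ ((Finset.univ : Finset V₁).val.map fun r => (c₁ l r, fR₁ v r)))
    (hc₂s : ∀ l w, c₂ (l + 1) w =
      Φ ((Finset.univ : Finset V₂).val.map fun s => (c₂ l s, fR₂ w s)))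
    -- S'-SEG-WL colorings
    (Φ₀' : (Fin d → ℝ) × C → C) (Φ' : Multiset (C × C) → C)
    (hΦ₀' : Function.Injective Φ₀') (hΦ' : Function.Injective Φ')
    (c₁' : ℕ → V₁ → C) (c₂' : ℕ → V₂ → C)
    (hc₁0' : ∀ v, c₁' 0 v = Φ₀' (X₁ v, fA₁' v))
    (hc₂0' : ∀ w, c₂' 0 w = Φ₀' (X₂ w, fA₂' w))
    (hc₁s' : ∀ l v, c₁' (l + 1) v =
      Φ' ((Finset.univ : Finset V₁).val.map fun r => (c₁' l r, fR₁' v r)))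
    (hc₂s' : ∀ l w, c₂' (l + 1) w =
      Φ' ((Finset.univ : Finset V₂).val.map fun s => (c₂' l s, fR₂' w s))) :
    ∀ (t : ℕ) (v : V₁) (w : V₂), c₁' t v = c₂' t w → c₁ t v = c₂ t w := by
  intro t
  induction t with
  | zero =>
    intro v w h
    rw [hc₁0', hc₂0'] at h
    have h2 := hΦ₀' h
    rw [Prod.mk.injEq] at h2
    rw [hc₁0, hc₂0, hpA₁, hpA₂, h2.1, h2.2]
  | succ l ih =>
    intro v w h
    rw [hc₁s', hc₂s'] at h
    have h2 := Multiset.rel_map.1 (Multiset.rel_eq.2 (hΦ' h))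
    rw [hc₁s, hc₂s]
    congr 1
    refine Multiset.rel_eq.1 (Multiset.rel_map.2 (h2.mono ?_))
    intro a _ b _ hab
    rw [Prod.mk.injEq] at hab ⊢
    exact ⟨ih a b hab.1, by rw [hpR₁, hpR₂, hab.2]⟩
end

section
/- Let S = (fA, fR) and S' = (fA', fR') be two structural encoding schemes on the same pair of graphs such that S' is a refinement of S, i.e. there are maps pA, pR : C → C with fAᵢ v = pA (fA'ᵢ v) and fRᵢ v u = pR (fR'ᵢ v u) for i ∈ {1,2} and all u, v ∈ Vᵢ. Let c denote the S-SEG-WL colorings (built from injective Φ₀, Φ) and c' the S'-SEG-WL colorings (built from injective Φ₀', Φ'). Then the S'-SEG-WL test is at least as expressive as the S-SEG-WL test and requires no more iterations: for every t ∈ ℕ, if the multiset of S-SEG-WL colors {c₁ t v : v ∈ V₁} differs from {c₂ t w : w ∈ V₂} (the S-SEG-WL test distinguishes the two graphs after t iterations), then the multiset {c'₁ t v : v ∈ V₁} differs from {c'₂ t w : w ∈ V₂} (the S'-SEG-WL test distinguishes them after at most t iterations). -/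
/-- **Theorem 3 of Zhu et al. (SEG-WL refinement): a refined scheme is at least as expressive.**
If `S' = (fA', fR')` refines `S = (fA, fR)` via maps `pA`, `pR`, then whenever the
`S`-SEG-WL test distinguishes the two graphs after `t` iterations (their color
multisets differ), the `S'`-SEG-WL test distinguishes them after at most `t`
iterations as well. -/
theorem seg_wl_refinement_more_expressive
    {V₁ V₂ C : Type*} [Fintype V₁] [Fintype V₂] [Nonempty V₁] [Nonempty V₂]
    {d : ℕ} (X₁ : V₁ → (Fin d → ℝ)) (X₂ : V₂ → (Fin d → ℝ))
    -- scheme S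
    (fA₁ : V₁ → C) (fA₂ : V₂ → C)
    (fR₁ : V₁ → V₁ → C) (fR₂ : V₂ → V₂ → C)
    -- scheme S'
    (fA₁' : V₁ → C) (fA₂' : V₂ → C)
    (fR₁' : V₁ → V₁ → C) (fR₂' : V₂ → V₂ → C)
    -- S' refines S
    (pA pR : C → C)
    (hpA₁ : ∀ v, fA₁ v = pA (fA₁' v)) (hpA₂ : ∀ w, fA₂ w = pA (fA₂' w))
    (hpR₁ : ∀ v u, fR₁ v u = pR (fR₁' v u)) (hpR₂ : ∀ w u, fR₂ w u = pR (fR₂' w u))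
    -- S-SEG-WL colorings
    (Φ₀ : (Fin d → ℝ) × C → C) (Φ : Multiset (C × C) → C)
    (hΦ₀ : Function.Injective Φ₀) (hΦ : Function.Injective Φ)
    (c₁ : ℕ → V₁ → C) (c₂ : ℕ → V₂ → C)
    (hc₁0 : ∀ v, c₁ 0 v = Φ₀ (X₁ v, fA₁ v))
    (hc₂0 : ∀ w, c₂ 0 w = Φ₀ (X₂ w, fA₂ w))
    (hc₁s : ∀ l v, c₁ (l + 1) v =
      Φ ((Finset.univ : Finset V₁).val.map fun r => (c₁ l r, fR₁ v r)))
    (hc₂s : ∀ l w, c₂ (l + 1) w =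
      Φ ((Finset.univ : Finset V₂).val.map fun s => (c₂ l s, fR₂ w s)))
    -- S'-SEG-WL colorings
    (Φ₀' : (Fin d → ℝ) × C → C) (Φ' : Multiset (C × C) → C)
    (hΦ₀' : Function.Injective Φ₀') (hΦ' : Function.Injective Φ')
    (c₁' : ℕ → V₁ → C) (c₂' : ℕ → V₂ → C)
    (hc₁0' : ∀ v, c₁' 0 v = Φ₀' (X₁ v, fA₁' v))
    (hc₂0' : ∀ w, c₂' 0 w = Φ₀' (X₂ w, fA₂' w))
    (hc₁s' : ∀ l v, c₁' (l + 1) v =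
      Φ' ((Finset.univ : Finset V₁).val.map fun r => (c₁' l r, fR₁' v r)))
    (hc₂s' : ∀ l w, c₂' (l + 1) w =
      Φ' ((Finset.univ : Finset V₂).val.map fun s => (c₂' l s, fR₂' w s))) :
    ∀ t : ℕ,
      (Finset.univ : Finset V₁).val.map (c₁ t) ≠
        (Finset.univ : Finset V₂).val.map (c₂ t) →
      (Finset.univ : Finset V₁).val.map (c₁' t) ≠
        (Finset.univ : Finset V₂).val.map (c₂' t) := by
  have key : ∀ t : ℕ, ∃ g : C → C, (∀ v, c₁ t v = g (c₁' t v)) ∧ (∀ w, c₂ t w = g (c₂' t w)) := by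
    haveI : Nonempty C := ⟨c₁ 0 (Classical.arbitrary V₁)⟩
    intro t
    induction t with
    | zero =>
      refine ⟨fun c => Φ₀ (Prod.map id pA (Function.invFun Φ₀' c)), ?_, ?_⟩
      · intro v
        simp only [hc₁0, hc₁0', Function.leftInverse_invFun hΦ₀' _, Prod.map, id, hpA₁]
      · intro w
        simp only [hc₂0, hc₂0', Function.leftInverse_invFun hΦ₀' _, Prod.map, id, hpA₂]
    | succ l ih =>
      obtain ⟨g, h1, h2⟩ := ih
      refine ⟨fun c => Φ ((Function.invFun Φ' c).map (Prod.map g pR)), ?_, ?_⟩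
      · intro v
        simp only [hc₁s, hc₁s', Function.leftInverse_invFun hΦ' _, Multiset.map_map,
          Function.comp_def, Prod.map, hpR₁, h1]
      · intro w
        simp only [hc₂s, hc₂s', Function.leftInverse_invFun hΦ' _, Multiset.map_map,
          Function.comp_def, Prod.map, hpR₂, h2]
  intro t hne heq
  obtain ⟨g, h1, h2⟩ := key t
  apply hne
  have h := congrArg (Multiset.map g) heq
  rw [Multiset.map_map, Multiset.map_map] at h
  rw [show c₁ t = g ∘ c₁' t from funext h1, show c₂ t = g ∘ c₂' t from funext h2]
  exact h
end

section
/- The k-MIP multi-head self-attention layer is equivariant with respect to row permutations whenever the attention scores have no ties: let X ∈ Matrix (Fin N) (Fin d) ℝ be such that for every head h ∈ Fin H and every row index i ∈ Fin N, the map j ↦ S^h(X) i j is injective. Then for every permutation σ ∈ Equiv.Perm (Fin N), kMIP (σ · X) = σ · (kMIP X), i.e. (kMIP (σ · X)) i t = (kMIP X) (σ i) t for all i ∈ Fin N, t ∈ Fin d. -/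
open Matrix

/-- The indices of the `k` largest entries of `s : Fin N → ℝ`, ties broken by index:
`j ∈ topkSet k s` iff fewer than `k` indices `j'` satisfy
`s j' > s j ∨ (s j' = s j ∧ j' < j)`. -/
noncomputable def topkSet {N : ℕ} (k : ℕ) (s : Fin N → ℝ) : Finset (Fin N) :=
  Finset.univ.filter fun j =>
    (Finset.univ.filter fun j' : Fin N => s j' > s j ∨ (s j' = s j ∧ j' < j)).card < k

/-- The score matrix of head `h`: `S^h(X) = (X Wq^h)(X Wk^h)ᵀ`. -/
noncomputable def scores {N d m : ℕ}
    (WQ WK : Matrix (Fin d) (Fin m) ℝ) (X : Matrix (Fin N) (Fin d) ℝ) :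
    Matrix (Fin N) (Fin N) ℝ :=
  (X * WQ) * (X * WK)ᵀ

/-- The k-MIP multi-head self-attention layer: per head, each query attends only
to its top-`k` keys by inner product (softmax restricted to that index set). -/
noncomputable def kMIPAttn {N d m H : ℕ} (k : ℕ)
    (WQ WK WV : Fin H → Matrix (Fin d) (Fin m) ℝ)
    (WO : Fin H → Matrix (Fin m) (Fin d) ℝ)
    (X : Matrix (Fin N) (Fin d) ℝ) : Matrix (Fin N) (Fin d) ℝ :=
  ∑ h : Fin H,
    (Matrix.of fun i j =>
        (if j ∈ topkSet k (scores (WQ h) (WK h) X i)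
          then Real.exp (scores (WQ h) (WK h) X i j / Real.sqrt m) else 0) /
        ∑ j' ∈ topkSet k (scores (WQ h) (WK h) X i),
          Real.exp (scores (WQ h) (WK h) X i j' / Real.sqrt m))
      * (X * WV h) * WO h

/-- The action of a permutation `σ` of `Fin N` on the rows of a matrix:
`(σ • M) i j = M (σ i) j`. -/
def permRows {N d : ℕ} (σ : Equiv.Perm (Fin N)) (M : Matrix (Fin N) (Fin d) ℝ) :
    Matrix (Fin N) (Fin d) ℝ :=
  Matrix.of fun i j => M (σ i) j

theorem mem_topkSet_comp {N : ℕ} (k : ℕ) (s : Fin N → ℝ) (hs : Function.Injective s)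
    (σ : Equiv.Perm (Fin N)) (j : Fin N) :
    j ∈ topkSet k (fun j => s (σ j)) ↔ σ j ∈ topkSet k s := by
  have key : ∀ (t : Fin N → ℝ), Function.Injective t → ∀ j,
      (Finset.univ.filter fun j' : Fin N => t j' > t j ∨ (t j' = t j ∧ j' < j))
        = Finset.univ.filter fun j' : Fin N => t j' > t j := by
    intro t ht j
    ext j'
    simp only [Finset.mem_filter, Finset.mem_univ, true_and]
    constructor
    · rintro (h | ⟨h, h'⟩)
      · exact h
      · exact absurd (ht h) h'.ne
    · exact Or.inl
  unfold topkSet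
  rw [Finset.mem_filter, Finset.mem_filter, key s hs,
    key (fun j => s (σ j)) (hs.comp σ.injective)]
  have hc : (Finset.univ.filter fun j' : Fin N => s (σ j') > s (σ j)).card
      = (Finset.univ.filter fun j' : Fin N => s j' > s (σ j)).card :=
    Finset.card_equiv σ (by simp)
  simp only [Finset.mem_univ, true_and, hc]

theorem scores_permRows {N d m : ℕ} (WQ WK : Matrix (Fin d) (Fin m) ℝ)
    (X : Matrix (Fin N) (Fin d) ℝ) (σ : Equiv.Perm (Fin N)) (i : Fin N) :
    scores WQ WK (permRows σ X) i = fun j => scores WQ WK X (σ i) (σ j) := by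
  ext j
  simp [scores, permRows, Matrix.mul_apply]

/-- **k-MIP self-attention is row-permutation equivariant whenever the attention
scores have no ties**: if for every head `h` and every row `i` the map
`j ↦ S^h(X) i j` is injective, then `kMIP (σ • X) = σ • (kMIP X)`. -/
theorem kMIPAttn_permRows_equivariant {N d m H k : ℕ}
    (hN : 1 ≤ N) (hd : 1 ≤ d) (hm : 1 ≤ m) (hH : 1 ≤ H)
    (hk1 : 1 ≤ k) (hkN : k ≤ N)
    (WQ WK WV : Fin H → Matrix (Fin d) (Fin m) ℝ)
    (WO : Fin H → Matrix (Fin m) (Fin d) ℝ)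
    (X : Matrix (Fin N) (Fin d) ℝ)
    (hties : ∀ (h : Fin H) (i : Fin N),
      Function.Injective fun j => scores (WQ h) (WK h) X i j)
    (σ : Equiv.Perm (Fin N)) :
    kMIPAttn k WQ WK WV WO (permRows σ X) = permRows σ (kMIPAttn k WQ WK WV WO X) := by
  ext i t
  simp only [kMIPAttn, permRows, Matrix.of_apply, Matrix.sum_apply]
  refine Finset.sum_congr rfl fun h _ => ?_
  rw [Matrix.mul_apply, Matrix.mul_apply]
  refine Finset.sum_congr rfl fun c _ => ?_
  congr 1
  rw [Matrix.mul_apply, Matrix.mul_apply]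
  refine Fintype.sum_equiv σ _ _ fun j => ?_
  have hsc := scores_permRows (WQ h) (WK h) X σ i
  have hmem := mem_topkSet_comp k (scores (WQ h) (WK h) X (σ i)) (hties h (σ i)) σ
  unfold permRows at hsc
  simp only [Matrix.of_apply, hsc, hmem]
  have hsum : ∑ j' ∈ topkSet k (fun j => scores (WQ h) (WK h) X (σ i) (σ j)),
      Real.exp (scores (WQ h) (WK h) X (σ i) (σ j') / Real.sqrt m)
      = ∑ j' ∈ topkSet k (scores (WQ h) (WK h) X (σ i)),
        Real.exp (scores (WQ h) (WK h) X (σ i) j' / Real.sqrt m) :=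
    Finset.sum_equiv σ hmem fun _ _ => rfl
  rw [hsum]
  simp only [Matrix.mul_apply, Matrix.of_apply]
end

section
/- Universal approximation of continuous permutation-equivariant functions by k-MIP transformers: let U ⊆ Matrix (Fin N) (Fin d) ℝ be compact and let f : Matrix (Fin N) (Fin d) ℝ → Matrix (Fin N) (Fin d) ℝ be continuous on U and equivariant with respect to row permutations on U (for every σ ∈ Equiv.Perm (Fin N) and every X ∈ U with σ · X ∈ U, f (σ · X) = σ · (f X)). Then for every real ε > 0, every real p with 1 ≤ p < ∞, and every k with 1 ≤ k ≤ N, there exists a k-MIP transformer T ∈ 𝒯_{k-MIP}^{2,1,4} such that (∫_U ‖f(X) − T(X)‖_p^p dX)^{1/p} < ε, where the integral is with respect to Lebesgue measure on Matrix (Fin N) (Fin d) ℝ ≅ ℝ^{N·d} and ‖Y‖_p = (∑_{i,j} |Y i j|^p)^{1/p} is the entrywise ℓ^p norm. -/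
open Matrix MeasureTheory

/-- A 2-layer ReLU MLP with hidden dimension `r`, applied row-wise:
`MLP(Z) = max(0, Z W₁ + 𝟙 b₁ᵀ) W₂ + 𝟙 b₂ᵀ`. -/
def mlp {N d r : ℕ} (W₁ : Matrix (Fin d) (Fin r) ℝ) (b₁ : Fin r → ℝ)
    (W₂ : Matrix (Fin r) (Fin d) ℝ) (b₂ : Fin d → ℝ)
    (Z : Matrix (Fin N) (Fin d) ℝ) : Matrix (Fin N) (Fin d) ℝ :=
  (Matrix.of fun i j => max 0 ((Z * W₁) i j + b₁ j)) * W₂ +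
    Matrix.of fun _ j => b₂ j

/-- A k-MIP transformer block: `X ↦ Z + MLP(Z)` where `Z = X + kMIP(X)`,
with residual connections around both the attention layer and the MLP. -/
noncomputable def kMIPBlock {N d m H r : ℕ} (k : ℕ)
    (WQ WK WV : Fin H → Matrix (Fin d) (Fin m) ℝ)
    (WO : Fin H → Matrix (Fin m) (Fin d) ℝ)
    (W₁ : Matrix (Fin d) (Fin r) ℝ) (b₁ : Fin r → ℝ)
    (W₂ : Matrix (Fin r) (Fin d) ℝ) (b₂ : Fin d → ℝ)
    (X : Matrix (Fin N) (Fin d) ℝ) : Matrix (Fin N) (Fin d) ℝ :=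
  X + kMIPAttn k WQ WK WV WO X +
    mlp W₁ b₁ W₂ b₂ (X + kMIPAttn k WQ WK WV WO X)

/-- The class `𝒯_{k-MIP}^{H,m,r}`: all finite compositions of k-MIP transformer
blocks with `H` heads, head dimension `m`, and MLP hidden dimension `r`
(over all choices of weights). -/
inductive IsKMIPTransformer (N d k H m r : ℕ) :
    (Matrix (Fin N) (Fin d) ℝ → Matrix (Fin N) (Fin d) ℝ) → Prop
  | single (WQ WK WV : Fin H → Matrix (Fin d) (Fin m) ℝ)
      (WO : Fin H → Matrix (Fin m) (Fin d) ℝ)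
      (W₁ : Matrix (Fin d) (Fin r) ℝ) (b₁ : Fin r → ℝ)
      (W₂ : Matrix (Fin r) (Fin d) ℝ) (b₂ : Fin d → ℝ) :
      IsKMIPTransformer N d k H m r (kMIPBlock k WQ WK WV WO W₁ b₁ W₂ b₂)
  | comp (WQ WK WV : Fin H → Matrix (Fin d) (Fin m) ℝ)
      (WO : Fin H → Matrix (Fin m) (Fin d) ℝ)
      (W₁ : Matrix (Fin d) (Fin r) ℝ) (b₁ : Fin r → ℝ)
      (W₂ : Matrix (Fin r) (Fin d) ℝ) (b₂ : Fin d → ℝ)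
      {T : Matrix (Fin N) (Fin d) ℝ → Matrix (Fin N) (Fin d) ℝ}
      (hT : IsKMIPTransformer N d k H m r T) :
      IsKMIPTransformer N d k H m r (fun X => kMIPBlock k WQ WK WV WO W₁ b₁ W₂ b₂ (T X))

section helpers

variable {N d k : ℕ}

theorem tt_comp {T₁ T₂ : Matrix (Fin N) (Fin d) ℝ → Matrix (Fin N) (Fin d) ℝ}
    (h₁ : IsKMIPTransformer N d k 2 1 4 T₁) (h₂ : IsKMIPTransformer N d k 2 1 4 T₂) :
    IsKMIPTransformer N d k 2 1 4 (fun X => T₂ (T₁ X)) := by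
  induction h₂ with
  | single WQ WK WV WO W₁ b₁ W₂ b₂ => exact .comp WQ WK WV WO W₁ b₁ W₂ b₂ h₁
  | comp WQ WK WV WO W₁ b₁ W₂ b₂ hT ih => exact .comp WQ WK WV WO W₁ b₁ W₂ b₂ ih

/-- The row-wise map `φ` is realised by a transformer. -/
def RowNet (N k : ℕ) {d : ℕ} (φ : (Fin d → ℝ) → (Fin d → ℝ)) : Prop :=
  IsKMIPTransformer N d k 2 1 4 (fun X => Matrix.of fun i => φ (X i))

theorem RowNet.comp {φ ψ : (Fin d → ℝ) → (Fin d → ℝ)} (hφ : RowNet N k φ)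
    (hψ : RowNet N k ψ) : RowNet N k (fun x => ψ (φ x)) :=
  tt_comp (T₁ := fun X => Matrix.of fun i => φ (X i)) (T₂ := fun X => Matrix.of fun i => ψ (X i))
    hφ hψ

theorem attn_zero (WQ WK : Fin 2 → Matrix (Fin d) (Fin 1) ℝ)
    (WO : Fin 2 → Matrix (Fin 1) (Fin d) ℝ) (X : Matrix (Fin N) (Fin d) ℝ) :
    kMIPAttn k WQ WK (fun _ => 0) WO X = 0 := by
  simp [kMIPAttn]

theorem rowNet_hinge (u v : Fin d → ℝ) (c s b : Fin 4 → ℝ) :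
    RowNet N k (fun x => x + (∑ l, c l * max 0 (s l * (u ⬝ᵥ x) + b l)) • v) := by
  have h := IsKMIPTransformer.single (N := N) (d := d) (k := k) (H := 2) (m := 1) (r := 4)
    (fun _ => 0) (fun _ => 0) (fun _ => 0) (fun _ => 0)
    (Matrix.of fun j l => s l * u j) b (Matrix.of fun l j => c l * v j) 0
  unfold RowNet
  convert h using 1
  funext X
  ext i j
  simp only [kMIPBlock, attn_zero, mlp, Matrix.add_apply, Matrix.of_apply, Matrix.mul_apply,
    Pi.add_apply, Pi.smul_apply, smul_eq_mul, dotProduct, Finset.sum_mul,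
    Pi.zero_apply, add_zero, Finset.mul_sum]
  congr 1
  refine Finset.sum_congr rfl fun l _ => ?_
  have : ∑ i_1, s l * (u i_1 * X i i_1) = ∑ x, X i x * (s l * u x) :=
    Finset.sum_congr rfl fun _ _ => by ring
  rw [this]; ring

theorem rowNet_id : RowNet N k (fun x : Fin d → ℝ => x) := by
  have := rowNet_hinge (N := N) (k := k) (d := d) 0 0 0 0 0
  simpa using this

theorem exists_sep (F : Finset (Fin d → ℝ)) (x₀ : Fin d → ℝ) :
    ∃ u : Fin d → ℝ, ∀ x ∈ F, x ≠ x₀ → u ⬝ᵥ x ≠ u ⬝ᵥ x₀ := by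
  have : Finite {x // x ∈ F ∧ x ≠ x₀} := (F.finite_toSet.subset fun x hx => hx.1).to_subtype
  obtain ⟨f, hf⟩ := Module.exists_dual_forall_apply_ne_zero (K := ℝ)
    (fun i : {x // x ∈ F ∧ x ≠ x₀} => i.1 - x₀) (fun i => sub_ne_zero.2 i.2.2)
  refine ⟨fun j => f (fun i => if j = i then 1 else 0), fun x hx hne h => ?_⟩
  have key : ∀ y, (fun j => f (fun i => if j = i then 1 else 0)) ⬝ᵥ y = f y := by
    intro y
    rw [LinearMap.pi_apply_eq_sum_univ f y]
    simp [dotProduct, mul_comm]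
  rw [key, key] at h
  exact hf ⟨x, hx, hne⟩ (by simp [h])

theorem rowNet_move (F : Finset (Fin d → ℝ)) (x₀ y₀ : Fin d → ℝ) :
    ∃ φ, RowNet N k φ ∧ φ x₀ = y₀ ∧ ∀ x ∈ F, x ≠ x₀ → φ x = x := by
  obtain ⟨u, hu⟩ := exists_sep F x₀
  obtain ⟨δ, hδ, hδF⟩ : ∃ δ > 0, ∀ x ∈ F, x ≠ x₀ → δ ≤ |u ⬝ᵥ x - u ⬝ᵥ x₀| := by
    have : ∀ᶠ δ in nhdsWithin (0 : ℝ) (Set.Ioi 0), ∀ x ∈ F, x ≠ x₀ → δ ≤ |u ⬝ᵥ x - u ⬝ᵥ x₀| := by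
      rw [Filter.eventually_all_finset]
      intro x hx
      by_cases h : x = x₀
      · simp [h]
      · have : 0 < |u ⬝ᵥ x - u ⬝ᵥ x₀| := abs_pos.2 (sub_ne_zero.2 (hu x hx h))
        filter_upwards [Ioo_mem_nhdsGT this] with δ hδ _ using hδ.2.le
    obtain ⟨δ, h1, h2⟩ := (this.and self_mem_nhdsWithin).exists
    exact ⟨δ, h2, h1⟩
  refine ⟨_, rowNet_hinge u (y₀ - x₀) ![1 / δ, -2 / δ, 1 / δ, 0] (fun _ => 1)
    ![-(u ⬝ᵥ x₀) + δ, -(u ⬝ᵥ x₀), -(u ⬝ᵥ x₀) - δ, 0], ?_, ?_⟩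
  · have : (1 : ℝ) / δ * max 0 δ + 1 / δ * max 0 (-δ) = 1 := by
      rw [max_eq_right hδ.le, max_eq_left (by linarith)]; field_simp; ring
    simp only [Fin.sum_univ_four]
    have e : u ⬝ᵥ x₀ + (-(u ⬝ᵥ x₀) - δ) = -δ := by ring
    simp [e] at this ⊢
    rw [this]; simp
  · intro x hx hne
    have h := hδF x hx hne
    simp only [Fin.sum_univ_four]
    simp only [Matrix.cons_val]
    generalize u ⬝ᵥ x = a at *
    generalize u ⬝ᵥ x₀ = b at *
    have : 1 / δ * max 0 (1 * a + (-b + δ)) + -2 / δ * max 0 (1 * a + -b)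
      + 1 / δ * max 0 (1 * a + (-b - δ)) + 0 * max 0 (1 * a + 0) = 0 := by
      rcases le_abs.1 h with h | h
      · rw [max_eq_right (by linarith), max_eq_right (by linarith), max_eq_right (by linarith)]
        ring
      · rw [max_eq_left (by linarith), max_eq_left (by linarith), max_eq_left (by linarith)]
        ring
    rw [this]; simp

theorem rowNet_memorize_aux (g : (Fin d → ℝ) → (Fin d → ℝ)) (A : Finset (Fin d → ℝ)) :
    ∀ B : Finset (Fin d → ℝ), Disjoint A B → (∀ x ∈ A, ∀ y ∈ A, g x ≠ y) →
    ∃ φ, RowNet N k φ ∧ (∀ x ∈ A, φ x = g x) ∧ ∀ y ∈ B, φ y = y := by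
  induction A using Finset.induction_on with
  | empty => exact fun B _ _ => ⟨_, rowNet_id, by simp⟩
  | insert a A ha ih =>
    intro B hB hg
    rw [Finset.disjoint_insert_left] at hB
    obtain ⟨ψ, hψ, hψa, hψF⟩ := rowNet_move (N := N) (k := k) (A ∪ B) a (g a)
    obtain ⟨φ, hφ, hφA, hφB⟩ := ih (insert (g a) B)
      (by
        rw [Finset.disjoint_insert_right]
        exact ⟨fun h => hg a (by simp) (g a) (by simp [h]) rfl, hB.2⟩)
      (fun x hx y hy => hg x (by simp [hx]) y (by simp [hy]))
    refine ⟨_, hψ.comp hφ, ?_, ?_⟩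
    · intro x hx
      rcases Finset.mem_insert.1 hx with rfl | hx
      · simp only [hψa]; exact hφB _ (by simp)
      · have : x ≠ a := fun h => ha (h ▸ hx)
        simp only [hψF x (by simp [hx]) this]
        exact hφA x hx
    · intro y hy
      have : y ≠ a := fun h => hB.1 (h ▸ hy)
      simp only [hψF y (by simp [hy]) this]
      exact hφB y (by simp [hy])

theorem rowNet_memorize (hd : 1 ≤ d) (F : Finset (Fin d → ℝ)) (g : (Fin d → ℝ) → (Fin d → ℝ)) :
    ∃ φ, RowNet N k φ ∧ ∀ x ∈ F, φ x = g x := by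
  classical
  have : Nonempty (Fin d) := ⟨⟨0, hd⟩⟩
  obtain ⟨t, ht⟩ := Infinite.exists_notMem_finset ((F ×ˢ F).image fun z => g z.1 - z.2)
  obtain ⟨φ, hφ, hφA, -⟩ := rowNet_memorize_aux (N := N) (k := k) (fun x => g (x - t))
    (F.image (fun x => x + t)) ∅ (by simp) (by
      intro x hx y hy h
      obtain ⟨x', hx', rfl⟩ := Finset.mem_image.1 hx
      obtain ⟨y', hy', rfl⟩ := Finset.mem_image.1 hy
      apply ht
      simp only [add_sub_cancel_right] at h
      exact Finset.mem_image.2 ⟨(x', y'), by simp [hx', hy'], by simp [h]⟩)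
  refine ⟨_, (rowNet_hinge 0 t ![1, 0, 0, 0] 0 1).comp hφ, fun x hx => ?_⟩
  have := hφA (x + t) (Finset.mem_image_of_mem _ hx)
  simpa [Fin.sum_univ_four] using this

theorem rowNet_clamp (M : ℝ) (hM : 0 ≤ M) (J : Finset (Fin d)) :
    ∃ φ, RowNet N k φ ∧ ∀ x : Fin d → ℝ, (∀ j ∈ J, |φ x j| ≤ M) ∧
      ((∀ j, |x j| ≤ M) → φ x = x) := by
  induction J using Finset.induction_on with
  | empty => exact ⟨_, rowNet_id, by simp⟩
  | insert a J ha ih =>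
    obtain ⟨φ, hφ, h⟩ := ih
    refine ⟨_, hφ.comp (rowNet_hinge (Pi.single a 1) (Pi.single a 1) ![-1, 1, 0, 0]
      ![1, -1, 1, 1] ![-M, -M, 0, 0]), ?_⟩
    intro x
    obtain ⟨h1, h2⟩ := h x
    have key : ∀ t : ℝ, t + (-1 * max 0 (t - M) + max 0 (-t - M)) = max (-M) (min M t) := by
      intro t
      rcases le_total t M with h | h <;> rcases le_total (-M) t with h' | h' <;>
      simp only [max_def, min_def] <;> split_ifs <;> linarith
    constructor
    · intro j hj
      by_cases hja : j = a
      · subst hja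
        have : |max (-M) (min M (φ x j))| ≤ M := by
          rw [abs_le]
          constructor
          · exact le_max_left _ _
          · exact max_le (by linarith) (min_le_left _ _)
        rw [← key] at this
        simpa [Fin.sum_univ_four, sub_eq_add_neg] using this
      · have := h1 j (by simpa [hja] using hj)
        simpa [Fin.sum_univ_four, hja] using this
    · intro hx
      rw [h2 hx]
      ext j
      have := key (x a)
      rw [min_eq_right (abs_le.1 (hx a)).2, max_eq_right (abs_le.1 (hx a)).1] at this
      have : (-1 * max 0 (x a - M) + max 0 (-x a - M)) = 0 := by linarith
      simp [sub_eq_add_neg] at this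
      simp [Fin.sum_univ_four, this]

theorem rowNet_quant (Δ w : ℝ) (hw : 0 < w) (hwΔ : w < Δ) (J : Finset (Fin d × ℤ)) :
    ∃ φ, RowNet N k φ ∧ ∀ (x : Fin d → ℝ) (m : Fin d → ℤ),
      (∀ j, m j * Δ ≤ x j ∧ x j ≤ m j * Δ + w) →
      ∀ j, φ x j = if (j, m j) ∈ J then m j * Δ else x j := by
  induction J using Finset.induction_on with
  | empty => exact ⟨_, rowNet_id, by simp⟩
  | insert a J ha ih =>
    obtain ⟨φ, hφ, h⟩ := ih
    obtain ⟨i, n⟩ := a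
    refine ⟨_, hφ.comp (rowNet_hinge (Pi.single i 1) (Pi.single i 1)
      ![-1, 1 + w / (Δ - w), -(w / (Δ - w)), 0] (fun _ => 1)
      ![-(n * Δ), -(n * Δ) - w, -(n * Δ) - Δ, 0]), ?_⟩
    intro x m hm j
    have hx := h x m hm
    by_cases hj : j = i
    swap
    · simp [hj, hx]
    subst hj
    have hd : 0 < Δ - w := by linarith
    have key : ∀ t : ℝ, m j * Δ ≤ t → t ≤ m j * Δ + w →
      t + (-1 * max 0 (t - n * Δ) + (1 + w / (Δ - w)) * max 0 (t - n * Δ - w)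
        + (-(w / (Δ - w))) * max 0 (t - n * Δ - Δ)) = if m j = n then n * Δ else t := by
      intro t h1 h2
      rcases lt_trichotomy (m j) n with hlt | heq | hgt
      · have : (m j : ℝ) + 1 ≤ n := by exact_mod_cast hlt
        have : t ≤ n * Δ := by nlinarith
        rw [max_eq_left (by linarith), max_eq_left (by linarith), max_eq_left (by linarith),
          if_neg hlt.ne]
        ring
      · rw [heq] at h1 h2
        rw [max_eq_right (by linarith), max_eq_left (by linarith), max_eq_left (by linarith),
          if_pos heq]
        ring
      · have : (n : ℝ) + 1 ≤ m j := by exact_mod_cast hgt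
        have : n * Δ + Δ ≤ t := by nlinarith
        rw [max_eq_right (by linarith), max_eq_right (by linarith), max_eq_right (by linarith),
          if_neg hgt.ne']
        field_simp
        ring
    have hφj : m j * Δ ≤ φ x j ∧ φ x j ≤ m j * Δ + w := by
      rw [hx j]
      split_ifs
      · constructor <;> linarith
      · exact hm j
    have := key (φ x j) hφj.1 hφj.2
    have e : φ x j + (∑ l, ![-1, 1 + w / (Δ - w), -(w / (Δ - w)), 0] l *
      max 0 (1 * ((Pi.single j 1 : Fin d → ℝ) ⬝ᵥ φ x) +
        ![-(n * Δ), -(n * Δ) - w, -(n * Δ) - Δ, 0] l)) = if m j = n then n * Δ else φ x j := by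
      rw [← this]
      simp only [Fin.sum_univ_four, Matrix.cons_val, single_dotProduct]
      ring_nf
    simp only [Pi.add_apply, Pi.smul_apply, Pi.single_eq_same, smul_eq_mul, mul_one]
    rw [e, hx j]
    by_cases hmn : m j = n
    · simp [hmn]
    · simp [hmn]

end helpers
section helpers2

variable {N d k : ℕ}

/-- scalar attention output -/
noncomputable def scAttn (k : ℕ) (c : ℝ) (x : Fin N → ℝ) (a : ℝ) : ℝ :=
  ∑ j, (if j ∈ topkSet k (fun j => c * a * x j) then Real.exp (c * a * x j) else 0) /
    (∑ j' ∈ topkSet k (fun j => c * a * x j), Real.exp (c * a * x j')) * x j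

theorem exists_argmax_mem_topk (hN : 1 ≤ N) (hk : 1 ≤ k) (s : Fin N → ℝ) :
    ∃ j ∈ topkSet k s, ∀ j', s j' ≤ s j := by
  classical
  have : Nonempty (Fin N) := ⟨⟨0, hN⟩⟩
  obtain ⟨j₁, hj₁⟩ := Finite.exists_max s
  have hne : (Finset.univ.filter fun j => ∀ j', s j' ≤ s j).Nonempty := ⟨j₁, by simpa using hj₁⟩
  obtain ⟨j₀, hj₀, hmin⟩ := Finset.exists_min_image _ id hne
  have h0 : ∀ j', s j' ≤ s j₀ := by simpa using hj₀
  refine ⟨j₀, ?_, h0⟩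
  simp only [topkSet, Finset.mem_filter, Finset.mem_univ, true_and]
  rw [Finset.card_eq_zero.2]
  · omega
  · rw [Finset.filter_eq_empty_iff]
    rintro j - (h | ⟨h, h'⟩)
    · exact absurd (h0 j) (not_le.2 h)
    · exact absurd (hmin j (by simpa [h] using h0)) (not_le.2 h')

theorem scAttn_bound (hN : 1 ≤ N) (hk : 1 ≤ k) (c : ℝ) (hc : 0 < c) (x : Fin N → ℝ) (a : ℝ)
    (ha : 0 < a) : |scAttn k c x a - ⨆ l, x l| ≤ N / (c * a) := by
  have : Nonempty (Fin N) := ⟨⟨0, hN⟩⟩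
  obtain ⟨j₀, hj₀, hmax⟩ := exists_argmax_mem_topk hN hk (fun j => c * a * x j)
  have hca : 0 < c * a := by positivity
  have hx : ∀ j, x j ≤ x j₀ := fun j => le_of_mul_le_mul_left (hmax j) hca
  have hs : ⨆ l, x l = x j₀ := le_antisymm (ciSup_le hx) (le_ciSup (Set.finite_range x).bddAbove j₀)
  rw [hs]
  set T := topkSet k (fun j => c * a * x j) with hT
  set D := ∑ j' ∈ T, Real.exp (c * a * x j') with hD
  have hDj : Real.exp (c * a * x j₀) ≤ D :=
    Finset.single_le_sum (f := fun j' => Real.exp (c * a * x j')) (fun _ _ => (Real.exp_pos _).le) hj₀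
  have hDpos : 0 < D := lt_of_lt_of_le (Real.exp_pos _) hDj
  have hsum : ∑ j, (if j ∈ T then Real.exp (c * a * x j) else 0) / D = 1 := by
    rw [← Finset.sum_div, Finset.sum_ite_mem, Finset.univ_inter, ← hD, div_self hDpos.ne']
  have e : scAttn k c x a - x j₀ =
      ∑ j, (if j ∈ T then Real.exp (c * a * x j) else 0) / D * (x j - x j₀) := by
    simp only [mul_sub, Finset.sum_sub_distrib, ← Finset.sum_mul, hsum, one_mul]
    rfl
  rw [e]
  refine (Finset.abs_sum_le_sum_abs _ _).trans ?_
  have : ∀ j ∈ (Finset.univ : Finset (Fin N)),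
      |(if j ∈ T then Real.exp (c * a * x j) else 0) / D * (x j - x j₀)| ≤ 1 / (c * a) := by
    intro j _
    split_ifs
    swap
    · simp; positivity
    rw [abs_mul, abs_of_pos (by positivity), abs_of_nonpos (by linarith [hx j]), div_mul_eq_mul_div,
      div_le_div_iff₀ hDpos hca]
    have h1 := Real.add_one_le_exp (c * a * (x j₀ - x j))
    have h2 : Real.exp (c * a * x j₀) = Real.exp (c * a * (x j₀ - x j)) * Real.exp (c * a * x j) := by
      rw [← Real.exp_add]; ring_nf
    have h3 := Real.exp_pos (c * a * x j)
    nlinarith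
  refine (Finset.sum_le_sum this).trans ?_
  simp [div_eq_mul_inv, mul_comm]

theorem scAttn_tendsto (hN : 1 ≤ N) (hk : 1 ≤ k) (x : Fin N → ℝ) (a : ℝ) (ha : 0 < a) :
    Filter.Tendsto (fun c => scAttn k c x a) Filter.atTop (nhds (⨆ l, x l)) := by
  rw [tendsto_iff_norm_sub_tendsto_zero]
  have h : Filter.Tendsto (fun c : ℝ => (N : ℝ) / (c * a)) Filter.atTop (nhds 0) :=
    (Filter.tendsto_id.atTop_mul_const ha).const_div_atTop _
  refine squeeze_zero' (.of_forall fun _ => norm_nonneg _) ?_ h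
  filter_upwards [Filter.eventually_gt_atTop 0] with c hc
  exact scAttn_bound hN hk c hc x a ha

/-- the attention block used -/
theorem attn_block (i₀ : Fin d) (c v : ℝ) :
    ∃ T, IsKMIPTransformer N d k 2 1 4 T ∧
      ∀ X i, T X i i₀ = X i i₀ + v * scAttn k c (fun l => X l i₀) (X i i₀) := by
  refine ⟨_, .single (fun _ => Matrix.of fun a _ => if a = i₀ then c else 0)
    (fun _ => Matrix.of fun a _ => if a = i₀ then 1 else 0)
    (fun _ => Matrix.of fun a _ => if a = i₀ then 1 else 0)
    ![Matrix.of fun _ a => if a = i₀ then v else 0, 0] 0 0 0 0, ?_⟩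
  intro X i
  have hs : scores (Matrix.of fun (a : Fin d) (_ : Fin 1) => if a = i₀ then c else 0)
      (Matrix.of fun a _ => if a = i₀ then 1 else 0) X i = fun j => c * X i i₀ * X j i₀ := by
    ext j
    simp [scores, Matrix.mul_apply, mul_comm]
  simp [kMIPBlock, mlp, kMIPAttn, hs, Matrix.mul_apply, scAttn]
  rw [mul_comm]

theorem attn_refine (hN : 1 ≤ N) (hk : 1 ≤ k) (i₀ : Fin d) (S : Set (Matrix (Fin N) (Fin d) ℝ))
    (hS : S.Finite) (hpos : ∀ X ∈ S, ∀ i, 0 < X i i₀) :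
    ∃ T, IsKMIPTransformer N d k 2 1 4 T ∧ ∀ X ∈ S, ∀ Y ∈ S, ∀ i j, T X i = T Y j →
      X i i₀ = Y j i₀ ∧ (⨆ l, X l i₀) = ⨆ l, Y l i₀ := by
  obtain ⟨v, hv⟩ : ∃ v : ℝ, ∀ X ∈ S, ∀ Y ∈ S, ∀ i j,
      ¬ (X i i₀ = Y j i₀ ∧ (⨆ l, X l i₀) = ⨆ l, Y l i₀) →
      X i i₀ + v * (⨆ l, X l i₀) ≠ Y j i₀ + v * (⨆ l, Y l i₀) := by
    have : ∀ᶠ v in nhdsWithin (0 : ℝ) (Set.Ioi 0), ∀ X ∈ S, ∀ Y ∈ S, ∀ i j,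
      ¬ (X i i₀ = Y j i₀ ∧ (⨆ l, X l i₀) = ⨆ l, Y l i₀) →
      X i i₀ + v * (⨆ l, X l i₀) ≠ Y j i₀ + v * (⨆ l, Y l i₀) := by
      simp only [Filter.eventually_all, Filter.eventually_all_finite hS]
      intro X hX Y hY i j h
      by_cases h1 : X i i₀ = Y j i₀
      · filter_upwards [self_mem_nhdsWithin] with v hv h2
        refine h ⟨h1, ?_⟩
        rw [h1] at h2
        exact mul_left_cancel₀ (ne_of_gt hv) (add_left_cancel h2)
      · have t : ∀ (p q : ℝ), Filter.Tendsto (fun v : ℝ => p + v * q)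
            (nhdsWithin (0 : ℝ) (Set.Ioi 0)) (nhds p) := by
          intro p q
          have : Continuous fun v : ℝ => p + v * q := by fun_prop
          have := this.tendsto 0
          simp only [zero_mul, add_zero] at this
          exact this.mono_left nhdsWithin_le_nhds
        exact (((t _ _).sub (t _ _)).eventually_ne (sub_ne_zero.2 h1)).mono
          fun v hv => sub_ne_zero.1 hv
    exact this.exists
  have : ∀ᶠ c in Filter.atTop, ∀ X ∈ S, ∀ Y ∈ S, ∀ i j,
      ¬ (X i i₀ = Y j i₀ ∧ (⨆ l, X l i₀) = ⨆ l, Y l i₀) →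
      X i i₀ + v * scAttn k c (fun l => X l i₀) (X i i₀) ≠
        Y j i₀ + v * scAttn k c (fun l => Y l i₀) (Y j i₀) := by
    simp only [Filter.eventually_all, Filter.eventually_all_finite hS]
    intro X hX Y hY i j h
    have h1 := ((scAttn_tendsto hN hk (fun l => X l i₀) _ (hpos X hX i)).const_mul v).const_add (X i i₀)
    have h2 := ((scAttn_tendsto hN hk (fun l => Y l i₀) _ (hpos Y hY j)).const_mul v).const_add (Y j i₀)
    exact ((h1.sub h2).eventually_ne (sub_ne_zero.2 (hv X hX Y hY i j h))).mono
      fun c hc => sub_ne_zero.1 hc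
  obtain ⟨c, hc⟩ := this.exists
  obtain ⟨T, hT, hTe⟩ := attn_block (N := N) (k := k) i₀ c v
  refine ⟨T, hT, fun X hX Y hY i j h => ?_⟩
  by_contra hne
  apply hc X hX Y hY i j hne
  rw [← hTe, ← hTe, h]

theorem contextual (hN : 1 ≤ N) (hd : 1 ≤ d) (hk : 1 ≤ k)
    (S : Set (Matrix (Fin N) (Fin d) ℝ)) (hS : S.Finite) :
    ∃ T, IsKMIPTransformer N d k 2 1 4 T ∧ ∀ X ∈ S, ∀ Y ∈ S, ∀ i j, T X i = T Y j →
      X i = Y j ∧ ∀ l, ∃ l', X l = Y l' := by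
  classical
  let i₀ : Fin d := ⟨0, hd⟩
  have : Finite S := hS
  have : Nonempty (Fin N) := ⟨⟨0, hN⟩⟩
  let ker : (Matrix (Fin N) (Fin d) ℝ → Matrix (Fin N) (Fin d) ℝ) →
    Set ((S × Fin N) × (S × Fin N)) := fun T => {z | T z.1.1 z.1.2 = T z.2.1 z.2.2}
  let C : Set (Set ((S × Fin N) × (S × Fin N))) :=
    {R | R ⊆ ker id ∧ ∃ T, IsKMIPTransformer N d k 2 1 4 T ∧ ker T = R}
  have hC : C.Nonempty := ⟨ker id, subset_rfl, _, rowNet_id, rfl⟩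
  obtain ⟨R, ⟨hR, T, hT, rfl⟩, hmin⟩ := (Set.toFinite C).exists_minimal hC
  -- any refinement of T has the same kernel
  have hmax : ∀ T', IsKMIPTransformer N d k 2 1 4 T' → ker T' ⊆ ker T → ker T ⊆ ker T' :=
    fun T' hT' h => hmin ⟨h.trans hR, T', hT', rfl⟩ h
  -- tokens
  let F : Finset (Fin d → ℝ) := (Set.toFinite (Set.range fun z : S × Fin N => T z.1 z.2)).toFinset
  have hF : ∀ X ∈ S, ∀ i, T X i ∈ F := by
    intro X hX i
    simp only [F, Set.Finite.mem_toFinset]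
    exact ⟨(⟨X, hX⟩, i), rfl⟩
  have main : ∀ X ∈ S, ∀ Y ∈ S, ∀ i j, T X i = T Y j → ∀ l, ∃ l', T X l = T Y l' := by
    intro X hX Y hY i j hij l
    obtain ⟨n, hn⟩ : ∃ n : (Fin d → ℝ) → ℕ, Set.InjOn n F :=
      (Set.countable_iff_exists_injOn.1 F.countable_toSet)
    let e : (Fin d → ℝ) → ℝ := fun t => if t = T X l then 1 else 1 / ((n t : ℝ) + 2)
    have e1 : ∀ t, t ≠ T X l → e t < 1 := by
      intro t ht
      simp only [e, if_neg ht]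
      rw [div_lt_one (by positivity)]
      have : (0 : ℝ) ≤ n t := by positivity
      linarith
    have epos : ∀ t, 0 < e t := by
      intro t
      simp only [e]
      split_ifs <;> positivity
    have etop : e (T X l) = 1 := by simp [e]
    have einj : Set.InjOn e F := by
      intro s hs t ht h
      by_cases h1 : s = T X l
      · by_cases h2 : t = T X l
        · rw [h1, h2]
        · have := e1 t h2
          rw [← h, h1, etop] at this
          exact absurd this (lt_irrefl _)
      · by_cases h2 : t = T X l
        · have := e1 s h1
          rw [h, h2, etop] at this
          exact absurd this (lt_irrefl _)
        · simp only [e, if_neg h1, if_neg h2] at h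
          rw [div_eq_div_iff (by positivity) (by positivity)] at h
          apply hn hs ht
          have : (n s : ℝ) = n t := by linarith
          exact_mod_cast this
    obtain ⟨φ, hφ, hφe⟩ := rowNet_memorize (N := N) (k := k) hd F (fun t _ => e t)
    let enc : Matrix (Fin N) (Fin d) ℝ → Matrix (Fin N) (Fin d) ℝ :=
      fun X => Matrix.of fun i => φ (T X i)
    have henc : IsKMIPTransformer N d k 2 1 4 enc := tt_comp (T₂ := fun X => Matrix.of fun i => φ (X i)) hT hφ
    have hencv : ∀ X ∈ S, ∀ i, enc X i i₀ = e (T X i) := by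
      intro X hX i
      have := congrFun (hφe (T X i) (hF X hX i)) i₀
      simpa [enc] using this
    obtain ⟨A, hA, hAr⟩ := attn_refine (k := k) hN hk i₀ (enc '' S) (hS.image _) (by
      rintro _ ⟨X, hX, rfl⟩ i
      rw [hencv X hX]; exact epos _)
    have hker : ker (fun X => A (enc X)) ⊆ ker T := by
      rintro ⟨⟨⟨X', hX'⟩, i'⟩, ⟨⟨Y', hY'⟩, j'⟩⟩ h
      have := (hAr _ ⟨X', hX', rfl⟩ _ ⟨Y', hY', rfl⟩ i' j' h).1
      rw [hencv _ hX', hencv _ hY'] at this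
      exact einj (hF _ hX' _) (hF _ hY' _) this
    have h2 : A (enc X) i = A (enc Y) j :=
      hmax _ (tt_comp henc hA) hker (show ((⟨X, hX⟩, i), (⟨Y, hY⟩, j)) ∈ ker T from hij)
    have h3 := (hAr _ ⟨X, hX, rfl⟩ _ ⟨Y, hY, rfl⟩ i j h2).2
    simp only [hencv X hX, hencv Y hY] at h3
    have h4 : e (T X l) ≤ ⨆ l, e (T X l) :=
      le_ciSup (f := fun l => e (T X l)) (Set.finite_range _).bddAbove l
    obtain ⟨l', hl'⟩ := exists_eq_ciSup_of_finite (f := fun l => e (T Y l))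
    refine ⟨l', ?_⟩
    by_contra hne
    have := e1 (T Y l') (Ne.symm hne)
    rw [etop, h3, ← hl'] at h4
    linarith
  refine ⟨T, hT, fun X hX Y hY i j hij => ⟨?_, fun l => ?_⟩⟩
  · exact hR (show ((⟨X, hX⟩, i), (⟨Y, hY⟩, j)) ∈ ker T from hij)
  · obtain ⟨l', hl'⟩ := main X hX Y hY i j hij l
    exact ⟨l', hR (show ((⟨X, hX⟩, l), (⟨Y, hY⟩, l')) ∈ ker T from hl')⟩

end helpers2
section helpers3

variable {N d k : ℕ}

theorem modulus (U : Set (Fin N → Fin d → ℝ)) (hU : IsCompact U)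
    (f : (Fin N → Fin d → ℝ) → (Fin N → Fin d → ℝ)) (hf : ContinuousOn f U)
    (hequiv : ∀ (σ : Equiv.Perm (Fin N)) (X : Fin N → Fin d → ℝ),
      X ∈ U → (fun i => X (σ i)) ∈ U → f (fun i => X (σ i)) = fun i => f X (σ i))
    (ε : ℝ) (hε : 0 < ε) :
    ∀ᶠ δ in nhdsWithin (0 : ℝ) (Set.Ioi 0), ∀ (σ : Equiv.Perm (Fin N)) (i : Fin N) (j : Fin d),
      ∀ X ∈ U, ∀ Y ∈ U, dist Y (fun i => X (σ i)) ≤ δ → |f Y i j - f X (σ i) j| ≤ ε := by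
  simp only [Filter.eventually_all]
  intro σ i j
  have hcont : ContinuousOn (fun z : (Fin N → Fin d → ℝ) × (Fin N → Fin d → ℝ) =>
      |f z.2 i j - f z.1 (σ i) j|) (U ×ˢ U) := by
    have h1 : ContinuousOn (fun z : (Fin N → Fin d → ℝ) × (Fin N → Fin d → ℝ) => f z.1) (U ×ˢ U) :=
      hf.comp continuousOn_fst fun z hz => hz.1
    have h2 : ContinuousOn (fun z : (Fin N → Fin d → ℝ) × (Fin N → Fin d → ℝ) => f z.2) (U ×ˢ U) :=
      hf.comp continuousOn_snd fun z hz => hz.2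
    have e : ∀ (a : Fin N) (b : Fin d), Continuous fun Z : Fin N → Fin d → ℝ => Z a b := by
      intro a b; fun_prop
    exact (((e i j).comp_continuousOn h2).sub ((e (σ i) j).comp_continuousOn h1)).abs
  have hUU := hU.prod hU
  have hZ : IsCompact ((U ×ˢ U) ∩ (fun z => |f z.2 i j - f z.1 (σ i) j|) ⁻¹' Set.Ici ε) :=
    hUU.of_isClosed_subset (hcont.preimage_isClosed_of_isClosed hUU.isClosed isClosed_Ici)
      Set.inter_subset_left
  rcases Set.eq_empty_or_nonempty
    ((U ×ˢ U) ∩ (fun z => |f z.2 i j - f z.1 (σ i) j|) ⁻¹' Set.Ici ε) with h | h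
  · refine .of_forall fun δ X hX Y hY _ => ?_
    by_contra! hlt
    have : (X, Y) ∈ (U ×ˢ U) ∩ (fun z => |f z.2 i j - f z.1 (σ i) j|) ⁻¹' Set.Ici ε :=
      ⟨⟨hX, hY⟩, hlt.le⟩
    rw [h] at this
    exact this
  · have hD : Continuous fun z : (Fin N → Fin d → ℝ) × (Fin N → Fin d → ℝ) =>
      dist z.2 (fun i => z.1 (σ i)) := by fun_prop
    obtain ⟨⟨X₀, Y₀⟩, ⟨⟨hX₀, hY₀⟩, hz⟩, hmin⟩ := hZ.exists_isMinOn h hD.continuousOn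
    have hpos : 0 < dist Y₀ (fun i => X₀ (σ i)) := by
      rw [dist_pos]
      rintro rfl
      have := hequiv σ X₀ hX₀ hY₀
      simp only [Set.mem_preimage, Set.mem_Ici, this, sub_self, abs_zero] at hz
      linarith
    filter_upwards [Ioo_mem_nhdsGT hpos] with δ hδ X hX Y hY hd
    by_contra! hlt
    have := hmin (show (X, Y) ∈ _ from ⟨⟨hX, hY⟩, hlt.le⟩)
    simp only [Set.mem_ofPred_eq] at this
    linarith [hδ.2]

theorem null_eq (i j : Fin N) (hij : i ≠ j) (a : Fin d) :
    volume {X : Fin N → Fin d → ℝ | X i a = X j a} = 0 := by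
  let P : Fin N → (Fin N → Fin d → ℝ) →ₗ[ℝ] ℝ := fun i =>
    (LinearMap.proj (R := ℝ) (φ := fun _ : Fin d => ℝ) a).comp
      (LinearMap.proj (R := ℝ) (φ := fun _ : Fin N => Fin d → ℝ) i)
  let L : (Fin N → Fin d → ℝ) →ₗ[ℝ] ℝ := P i - P j
  have h := Measure.addHaar_submodule (volume : Measure (Fin N → Fin d → ℝ)) (LinearMap.ker L) (by
    intro h
    have : (Pi.single i (fun _ => 1) : Fin N → Fin d → ℝ) ∈ LinearMap.ker L := by rw [h]; trivial
    simp [L, P, hij.symm] at this)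
  convert h using 2
  ext X
  simp [L, P, sub_eq_zero]

theorem small_diag (U : Set (Fin N → Fin d → ℝ)) (hU : IsCompact U) (a : Fin d)
    (δ : ENNReal) (hδ : 0 < δ) :
    (∀ Δ : ℝ, MeasurableSet {X ∈ U | ∃ i j, i ≠ j ∧ |X i a - X j a| ≤ Δ}) ∧
    ∀ᶠ n : ℕ in Filter.atTop,
      volume {X ∈ U | ∃ i j, i ≠ j ∧ |X i a - X j a| ≤ 1 / ((n : ℝ) + 1)} < δ := by
  have hm : ∀ Δ : ℝ, MeasurableSet {X ∈ U | ∃ i j, i ≠ j ∧ |X i a - X j a| ≤ Δ} := by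
    intro Δ
    have e : {X ∈ U | ∃ i j, i ≠ j ∧ |X i a - X j a| ≤ Δ} =
        U ∩ ⋃ i, ⋃ j, {X | i ≠ j ∧ |X i a - X j a| ≤ Δ} := by
      ext X; simp
    rw [e]
    refine hU.measurableSet.inter (.iUnion fun i => .iUnion fun j => ?_)
    by_cases h : i = j
    · simp [h]
    · simp only [ne_eq, h, not_false_eq_true, true_and]
      exact measurableSet_le (by fun_prop) (by fun_prop)
  refine ⟨hm, ?_⟩
  have ht := tendsto_measure_iInter_atTop (μ := (volume : Measure (Fin N → Fin d → ℝ)))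
    (s := fun n : ℕ => {X ∈ U | ∃ i j, i ≠ j ∧ |X i a - X j a| ≤ 1 / ((n : ℝ) + 1)})
    (fun n => (hm _).nullMeasurableSet) (by
      rintro n m hnm X ⟨hX, i, j, hij, h⟩
      refine ⟨hX, i, j, hij, h.trans ?_⟩
      exact one_div_le_one_div_of_le (by positivity) (by exact_mod_cast Nat.succ_le_succ hnm))
    ⟨0, ((measure_mono (fun X hX => hX.1)).trans_lt hU.measure_lt_top).ne⟩
  have h0 : volume (⋂ n : ℕ, {X ∈ U | ∃ i j, i ≠ j ∧ |X i a - X j a| ≤ 1 / ((n : ℝ) + 1)}) = 0 := by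
    have hz : volume (⋃ i : Fin N, ⋃ j : Fin N, ⋃ _ : i ≠ j,
        {X : Fin N → Fin d → ℝ | X i a = X j a}) = 0 := by
      simp only [measure_iUnion_null_iff]
      exact fun i j hij => null_eq i j hij a
    refine measure_mono_null ?_ hz
    intro X hX
    simp only [Set.mem_iUnion, Set.mem_ofPred_eq]
    by_contra! hne
    have : ∀ᶠ n : ℕ in Filter.atTop, ∀ i j : Fin N, i ≠ j → 1 / ((n : ℝ) + 1) < |X i a - X j a| := by
      simp only [Filter.eventually_all]
      intro i j hij
      exact tendsto_one_div_add_atTop_nhds_zero_nat.eventually_lt_const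
        (abs_pos.2 (sub_ne_zero.2 (hne i j hij)))
    obtain ⟨n, hn⟩ := this.exists
    obtain ⟨-, i, j, hij, h⟩ := Set.mem_iInter.1 hX n
    exact absurd h (not_le.2 (hn i j hij))
  rw [h0] at ht
  exact ht.eventually_lt_const hδ

theorem small_gap (U : Set (Fin N → Fin d → ℝ)) (hU : IsCompact U) (Δ : ℝ) (hΔ : 0 < Δ)
    (δ : ENNReal) (hδ : 0 < δ) : ∃ w, 0 < w ∧ w < Δ ∧
      MeasurableSet {X ∈ U | ∃ i j, w < Δ * Int.fract (X i j / Δ)} ∧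
      volume {X ∈ U | ∃ i j, w < Δ * Int.fract (X i j / Δ)} < δ := by
  have hm : ∀ w : ℝ, MeasurableSet {X ∈ U | ∃ i j, w < Δ * Int.fract (X i j / Δ)} := by
    intro w
    have e : {X ∈ U | ∃ i j, w < Δ * Int.fract (X i j / Δ)} =
        U ∩ ⋃ i, ⋃ j, {X | w < Δ * Int.fract (X i j / Δ)} := by
      ext X; simp
    rw [e]
    refine hU.measurableSet.inter (.iUnion fun i => .iUnion fun j => ?_)
    refine measurableSet_lt (by fun_prop) ?_
    refine (measurable_fract.comp ?_).const_mul Δ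
    fun_prop
  let w : ℕ → ℝ := fun n => Δ * (1 - 1 / ((n : ℝ) + 2))
  have hw : Filter.Tendsto w Filter.atTop (nhds Δ) := by
    have h1 : Filter.Tendsto (fun n : ℕ => 1 / ((n : ℝ) + 2)) Filter.atTop (nhds 0) := by
      refine Filter.Tendsto.const_div_atTop ?_ _
      exact Filter.tendsto_atTop_add_const_right _ _ tendsto_natCast_atTop_atTop
    simpa [w] using (h1.const_sub 1).const_mul Δ
  have ht := tendsto_measure_iInter_atTop (μ := (volume : Measure (Fin N → Fin d → ℝ)))
    (s := fun n : ℕ => {X ∈ U | ∃ i j, w n < Δ * Int.fract (X i j / Δ)})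
    (fun n => (hm _).nullMeasurableSet) (by
      rintro n m hnm X ⟨hX, i, j, h⟩
      refine ⟨hX, i, j, lt_of_le_of_lt ?_ h⟩
      refine mul_le_mul_of_nonneg_left (sub_le_sub_left ?_ _) hΔ.le
      exact one_div_le_one_div_of_le (by positivity) (by exact_mod_cast Nat.add_le_add_right hnm 2))
    ⟨0, ((measure_mono (fun X hX => hX.1)).trans_lt hU.measure_lt_top).ne⟩
  have h0 : (⋂ n : ℕ, {X ∈ U | ∃ i j, w n < Δ * Int.fract (X i j / Δ)}) = ∅ := by
    rw [Set.eq_empty_iff_forall_notMem]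
    intro X hX
    have : ∀ᶠ n : ℕ in Filter.atTop, ∀ i j, Δ * Int.fract (X i j / Δ) < w n := by
      simp only [Filter.eventually_all]
      intro i j
      refine hw.eventually_const_lt ?_
      nlinarith [Int.fract_lt_one (X i j / Δ)]
    obtain ⟨n, hn⟩ := this.exists
    obtain ⟨-, i, j, h⟩ := Set.mem_iInter.1 hX n
    exact absurd h (not_lt.2 (hn i j).le)
  rw [h0, measure_empty] at ht
  obtain ⟨n, hn⟩ := (ht.eventually_lt_const hδ).exists
  refine ⟨w n, ?_, ?_, hm _, hn⟩
  · have : 1 / ((n : ℝ) + 2) < 1 := by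
      rw [div_lt_one (by positivity)]; have : (0 : ℝ) ≤ n := by positivity
      linarith
    have : 0 < 1 - 1 / ((n : ℝ) + 2) := by linarith
    positivity
  · have : 0 < 1 / ((n : ℝ) + 2) := by positivity
    simp only [w]
    nlinarith

theorem approx_good (hN : 1 ≤ N) (hd : 1 ≤ d) (hk : 1 ≤ k)
    (U : Set (Fin N → Fin d → ℝ)) (hU : IsCompact U)
    (f : (Fin N → Fin d → ℝ) → (Fin N → Fin d → ℝ)) (hf : ContinuousOn f U)
    (hequiv : ∀ (σ : Equiv.Perm (Fin N)) (X : Fin N → Fin d → ℝ),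
      X ∈ U → (fun i => X (σ i)) ∈ U → f (fun i => X (σ i)) = fun i => f X (σ i))
    (ε : ℝ) (hε : 0 < ε) (M : ℝ) (hM : 0 ≤ M) (hfM : ∀ X ∈ U, ∀ i j, |f X i j| ≤ M)
    (δ : ENNReal) (hδ : 0 < δ) :
    ∃ T : Matrix (Fin N) (Fin d) ℝ → Matrix (Fin N) (Fin d) ℝ,
      IsKMIPTransformer N d k 2 1 4 T ∧ ∃ B : Set (Fin N → Fin d → ℝ), MeasurableSet B ∧
      volume B ≤ δ + δ ∧ (∀ X i j, |T X i j| ≤ M) ∧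
      ∀ X ∈ U, X ∉ B → ∀ i j, |f X i j - T X i j| ≤ ε := by
  classical
  let i₀ : Fin d := ⟨0, hd⟩
  -- scales
  have hmod := modulus U hU f hf hequiv ε hε
  obtain ⟨hDm, hDs⟩ := small_diag U hU i₀ δ hδ
  have htend : Filter.Tendsto (fun n : ℕ => 1 / ((n : ℝ) + 1)) Filter.atTop
      (nhdsWithin (0 : ℝ) (Set.Ioi 0)) :=
    tendsto_nhdsWithin_iff.2 ⟨tendsto_one_div_add_atTop_nhds_zero_nat,
      .of_forall fun n => by simp only [Set.mem_Ioi]; positivity⟩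
  obtain ⟨n, hn1, hn2⟩ := ((htend.eventually hmod).and hDs).exists
  obtain ⟨Δ, hΔe⟩ : ∃ Δ : ℝ, Δ = 1 / ((n : ℝ) + 1) := ⟨_, rfl⟩
  have hΔ : 0 < Δ := by rw [hΔe]; positivity
  rw [← hΔe] at hn1 hn2
  obtain ⟨w, hw, hwΔ, hGm, hGs⟩ := small_gap U hU Δ hΔ δ hδ
  obtain ⟨R, hR⟩ : ∃ R : ℝ, ∀ X ∈ U, ∀ i j, |X i j| ≤ R := by
    obtain ⟨R, hR⟩ := hU.isBounded.exists_norm_le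
    exact ⟨R, fun X hX i j => ((norm_le_pi_norm (X i) j).trans (norm_le_pi_norm X i)).trans (hR X hX)⟩
  obtain ⟨φ, hφ, hφq⟩ := rowNet_quant (N := N) (k := k) (d := d) Δ w hw hwΔ
    (Finset.univ ×ˢ Finset.Icc ⌊-R / Δ⌋ ⌊R / Δ⌋)
  set B : Set (Fin N → Fin d → ℝ) := {X ∈ U | ∃ i j, i ≠ j ∧ |X i i₀ - X j i₀| ≤ Δ} ∪
    {X ∈ U | ∃ i j, w < Δ * Int.fract (X i j / Δ)} with hB
  have hfl : ∀ X ∈ U, ∀ i j, ⌊X i j / Δ⌋ ∈ Finset.Icc ⌊-R / Δ⌋ ⌊R / Δ⌋ := by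
    intro X hX i j
    have := abs_le.1 (hR X hX i j)
    rw [Finset.mem_Icc]
    constructor <;> apply Int.floor_le_floor <;> gcongr
    · exact this.1
    · exact this.2
  have hcell : ∀ X ∈ U, X ∉ B → ∀ i j, (⌊X i j / Δ⌋ : ℝ) * Δ ≤ X i j ∧
      X i j ≤ ⌊X i j / Δ⌋ * Δ + w := by
    intro X hX hXB i j
    have h1 : Δ * Int.fract (X i j / Δ) ≤ w := by
      by_contra! h
      exact hXB (Or.inr ⟨hX, i, j, h⟩)
    have h2 := Int.fract_nonneg (X i j / Δ)
    have h3 : X i j = ⌊X i j / Δ⌋ * Δ + Δ * Int.fract (X i j / Δ) := by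
      have := Int.floor_add_fract (X i j / Δ)
      calc X i j = X i j / Δ * Δ := by field_simp
        _ = (⌊X i j / Δ⌋ + Int.fract (X i j / Δ)) * Δ := by rw [this]
        _ = _ := by ring
    constructor
    · nlinarith
    · linarith
  have hQ : ∀ X ∈ U, X ∉ B → ∀ i j, φ (X i) j = ⌊X i j / Δ⌋ * Δ := by
    intro X hX hXB i j
    rw [hφq (X i) (fun j => ⌊X i j / Δ⌋) (hcell X hX hXB i) j, if_pos]
    exact Finset.mem_product.2 ⟨Finset.mem_univ _, hfl X hX i j⟩
  let Q : Matrix (Fin N) (Fin d) ℝ → Matrix (Fin N) (Fin d) ℝ := fun X => Matrix.of fun i => φ (X i)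
  have hQv : ∀ X i, Q X i = φ (X i) := fun X i => rfl
  let S : Set (Matrix (Fin N) (Fin d) ℝ) := Q '' {X | X ∈ U ∧ X ∉ B}
  have hS : S.Finite := by
    refine (Set.finite_range (fun m : Fin N → Fin d → Finset.Icc ⌊-R / Δ⌋ ⌊R / Δ⌋ =>
      (Matrix.of fun i j => ((m i j : ℤ) : ℝ) * Δ : Matrix (Fin N) (Fin d) ℝ))).subset ?_
    rintro _ ⟨X, ⟨hX, hXB⟩, rfl⟩
    refine ⟨fun i j => ⟨⌊X i j / Δ⌋, hfl X hX i j⟩, ?_⟩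
    ext i j
    exact (hQ X hX hXB i j).symm
  obtain ⟨T₀, hT₀, hctx⟩ := contextual (k := k) hN hd hk S hS
  -- the tokens
  let τ : (Fin N → Fin d → ℝ) × Fin N → (Fin d → ℝ) := fun z => T₀ (Q z.1) z.2
  let D : Set ((Fin N → Fin d → ℝ) × Fin N) := {z | z.1 ∈ U ∧ z.1 ∉ B}
  have hτfin : (τ '' D).Finite := by
    refine ((hS.prod (Set.finite_univ (α := Fin N))).image (fun z => T₀ z.1 z.2)).subset ?_
    rintro _ ⟨⟨X, i⟩, hX, rfl⟩
    exact ⟨(Q X, i), ⟨⟨X, hX, rfl⟩, trivial⟩, rfl⟩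
  have hsel : ∀ t : Fin d → ℝ, ∃ z : (Fin N → Fin d → ℝ) × Fin N, t ∈ τ '' D → z ∈ D ∧ τ z = t := by
    intro t
    by_cases h : t ∈ τ '' D
    · obtain ⟨z, hz, hzt⟩ := h
      exact ⟨z, fun _ => ⟨hz, hzt⟩⟩
    · exact ⟨(0, ⟨0, hN⟩), fun h' => absurd h' h⟩
  choose rep hrep using hsel
  obtain ⟨ψ, hψ, hψv⟩ := rowNet_memorize (N := N) (k := k) hd hτfin.toFinset
    (fun t => f (rep t).1 (rep t).2)
  obtain ⟨χ, hχ, hχv⟩ := rowNet_clamp (N := N) (k := k) (d := d) M hM Finset.univ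
  refine ⟨fun X => Matrix.of fun i => χ (ψ (T₀ (Q X) i)), ?_, B, hDm Δ |>.union hGm, ?_, ?_, ?_⟩
  · have h1 : IsKMIPTransformer N d k 2 1 4 (fun X => T₀ (Q X)) := tt_comp hφ hT₀
    exact tt_comp (T₂ := fun X => Matrix.of fun i => χ (ψ (X i))) h1 (hψ.comp hχ)
  · exact (measure_union_le _ _).trans (add_le_add hn2.le hGs.le)
  · intro X i j
    exact (hχv _).1 j (Finset.mem_univ _)
  · intro X hX hXB i j
    have hmem : τ (X, i) ∈ τ '' D := ⟨(X, i), ⟨hX, hXB⟩, rfl⟩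
    obtain ⟨hzD, hzτ⟩ := hrep _ hmem
    have hv := hψv (τ (X, i)) (by simpa using hmem)
    obtain ⟨⟨Y, i'⟩, hz⟩ : ∃ z, z = rep (τ (X, i)) := ⟨_, rfl⟩
    rw [← hz] at hzD hzτ hv
    obtain ⟨hY, hYB⟩ := hzD
    simp only at hY hYB hv
    have hval : χ (ψ (T₀ (Q X) i)) = f Y i' := by
      change χ (ψ (τ (X, i))) = _
      rw [hv]
      exact (hχv _).2 (hfM Y hY i')
    simp only [Matrix.of_apply]
    rw [hval]
    -- find the permutation
    obtain ⟨hrow, hperm⟩ := hctx (Q Y) ⟨Y, ⟨hY, hYB⟩, rfl⟩ (Q X) ⟨X, ⟨hX, hXB⟩, rfl⟩ i' i hzτ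
    have hclose : ∀ X ∈ U, X ∉ B → ∀ Y ∈ U, Y ∉ B → ∀ a b, Q X a = Q Y b →
        ∀ j, |X a j - Y b j| ≤ w := by
      intro X hX hXB Y hY hYB a b h j
      have : φ (X a) j = φ (Y b) j := congrFun h j
      rw [hQ X hX hXB, hQ Y hY hYB] at this
      have h1 := hcell X hX hXB a j
      have h2 := hcell Y hY hYB b j
      rw [abs_le]
      constructor <;> linarith
    have hinj : ∀ X ∈ U, X ∉ B → ∀ a b, Q X a = Q X b → a = b := by
      intro X hX hXB a b h
      by_contra hne
      exact hXB (Or.inl ⟨hX, a, b, hne, (hclose X hX hXB X hX hXB a b h i₀).trans hwΔ.le⟩)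
    choose s hs using hperm
    have hsinj : Function.Injective s := by
      intro a b hab
      apply hinj Y hY hYB
      rw [hs a, hs b, hab]
    let σ : Equiv.Perm (Fin N) := Equiv.ofBijective s (Finite.injective_iff_bijective.1 hsinj)
    have hσ : ∀ l, σ l = s l := fun l => rfl
    have hsi : s i' = i := hinj X hX hXB _ _ (by rw [← hs, hrow])
    have hdist : dist Y (fun l => X (σ l)) ≤ Δ := by
      rw [dist_pi_le_iff hΔ.le]
      intro a
      rw [dist_pi_le_iff hΔ.le]
      intro b
      exact (hclose Y hY hYB X hX hXB a (s a) (hs a) b).trans hwΔ.le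
    have := hn1 σ i' j X hX Y hY hdist
    rw [hσ, hsi] at this
    rwa [abs_sub_comm]

end helpers3
/-- **Universal approximation of continuous permutation-equivariant functions by
k-MIP transformers** (the analogue of Theorem 2 of Yun et al. for k-MIP
attention): every function that is continuous and row-permutation equivariant
on a compact set `U` can be approximated in entrywise `ℓᵖ` norm, in the
`L^p(U)` sense, by a k-MIP transformer from the class `𝒯_{k-MIP}^{2,1,4}`. -/
theorem kMIP_universal_approximation {N d : ℕ} (hN : 1 ≤ N) (hd : 1 ≤ d)
    (k : ℕ) (hk1 : 1 ≤ k) (hkN : k ≤ N)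
    (U : Set (Matrix (Fin N) (Fin d) ℝ)) (hU : IsCompact U)
    (f : Matrix (Fin N) (Fin d) ℝ → Matrix (Fin N) (Fin d) ℝ)
    (hf : ContinuousOn f U)
    (hequiv : ∀ (σ : Equiv.Perm (Fin N)) (X : Matrix (Fin N) (Fin d) ℝ),
      X ∈ U → permRows σ X ∈ U → f (permRows σ X) = permRows σ (f X))
    (ε : ℝ) (hε : 0 < ε) (p : ℝ) (hp : 1 ≤ p) :
    ∃ T : Matrix (Fin N) (Fin d) ℝ → Matrix (Fin N) (Fin d) ℝ,
      IsKMIPTransformer N d k 2 1 4 T ∧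
      (∫ X in U, ∑ i : Fin N, ∑ j : Fin d, |f X i j - T X i j| ^ p
          ∂(volume : Measure (Fin N → Fin d → ℝ))) ^ (1 / p) < ε := by
  have hfE : ContinuousOn (fun X : Fin N → Fin d → ℝ => (f X : Fin N → Fin d → ℝ)) U := hf
  have hUE : IsCompact (X := Fin N → Fin d → ℝ) U := hU
  obtain ⟨M, hM, hfM⟩ : ∃ M : ℝ, 0 ≤ M ∧ ∀ X ∈ U, ∀ i j, |f X i j| ≤ M := by
    let g : (Fin N → Fin d → ℝ) → (Fin N → Fin d → ℝ) := f
    have hg : ContinuousOn g U := hf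
    obtain ⟨R, hR⟩ := (hUE.image_of_continuousOn hg).isBounded.exists_norm_le
    refine ⟨max R 0, le_max_right _ _, fun X hX i j => ?_⟩
    have h1 : ‖g X‖ ≤ R := hR _ ⟨X, hX, rfl⟩
    have h2 : ‖g X i j‖ ≤ R :=
      ((norm_le_pi_norm _ j).trans (norm_le_pi_norm (g X) i)).trans h1
    exact h2.trans (le_max_left _ _)
  have hp0 : 0 < p := by linarith
  let V : ℝ := (volume : Measure (Fin N → Fin d → ℝ)).real U
  have hV : 0 ≤ V := measureReal_nonneg
  let C : ℝ := (N : ℝ) * d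
  have hC : 0 ≤ C := by positivity
  let e₀ : ℝ := ε ^ p
  have he₀ : 0 < e₀ := Real.rpow_pos_of_pos hε p
  let ε₁ : ℝ := (e₀ / (2 * (C * V + 1))) ^ (1 / p)
  have hε₁ : 0 < ε₁ := by positivity
  have hε₁p : ε₁ ^ p = e₀ / (2 * (C * V + 1)) := by
    rw [← Real.rpow_mul (by positivity), one_div_mul_cancel hp0.ne', Real.rpow_one]
  let K : ℝ := C * (2 * M) ^ p
  have hK : 0 ≤ K := by positivity
  let δ : ℝ := e₀ / (8 * (K + 1))
  have hδ : 0 < δ := by positivity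
  obtain ⟨T, hT, B, hBm, hBv, hTM, hTf⟩ := approx_good (k := k) hN hd hk1 U hUE
    (fun X => f X) hfE hequiv ε₁ hε₁ M hM hfM (ENNReal.ofReal δ) (by simpa using hδ)
  refine ⟨T, hT, ?_⟩
  have hBr : (volume : Measure (Fin N → Fin d → ℝ)).real B ≤ 2 * δ := by
    rw [← ENNReal.ofReal_add hδ.le hδ.le] at hBv
    have := ENNReal.toReal_mono ENNReal.ofReal_ne_top hBv
    rw [ENNReal.toReal_ofReal (by linarith)] at this
    calc _ ≤ δ + δ := this
      _ = _ := by ring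
  have hbound : ∫ X in U, ∑ i : Fin N, ∑ j : Fin d, |f X i j - T X i j| ^ p
      ∂(volume : Measure (Fin N → Fin d → ℝ)) ≤
      ∫ X in U, (C * ε₁ ^ p + B.indicator (fun _ => K) X)
        ∂(volume : Measure (Fin N → Fin d → ℝ)) := by
    have hfin : IsFiniteMeasure ((volume : Measure (Fin N → Fin d → ℝ)).restrict U) :=
      isFiniteMeasure_restrict.2 hUE.measure_lt_top.ne
    refine integral_mono_of_nonneg (.of_forall fun X => ?_) ?_ ?_
    · exact Finset.sum_nonneg fun i _ => Finset.sum_nonneg fun j _ => by positivity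
    · exact (integrable_const _).add ((integrable_const _).indicator hBm)
    · refine (ae_restrict_iff' hUE.measurableSet).2 (.of_forall fun X hX => ?_)
      have hsum : ∀ c : ℝ, (∀ i j, |f X i j - T X i j| ^ p ≤ c) →
          ∑ i : Fin N, ∑ j : Fin d, |f X i j - T X i j| ^ p ≤ C * c := by
        intro c hc
        refine (Finset.sum_le_sum fun i _ => Finset.sum_le_sum fun j _ => hc i j).trans ?_
        simp [C, mul_assoc]
      by_cases hXB : X ∈ B
      · have h1 := hsum ((2 * M) ^ p) (fun i j => by
          refine Real.rpow_le_rpow (abs_nonneg _) ?_ hp0.le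
          have h1 := abs_le.1 (hfM X hX i j)
          have h2 := abs_le.1 (hTM X i j)
          rw [abs_le]
          constructor <;> linarith)
        have h2 : 0 ≤ C * ε₁ ^ p := by positivity
        simp only [Set.indicator_of_mem hXB]
        simp only [K]
        linarith
      · have h1 := hsum (ε₁ ^ p) (fun i j =>
          Real.rpow_le_rpow (abs_nonneg _) (hTf X hX hXB i j) hp0.le)
        simpa only [Set.indicator_of_notMem hXB, add_zero] using h1
  have hval : ∫ X in U, (C * ε₁ ^ p + B.indicator (fun _ => K) X)
        ∂(volume : Measure (Fin N → Fin d → ℝ)) ≤ V * (C * ε₁ ^ p) + 2 * δ * K := by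
    have hfin : IsFiniteMeasure ((volume : Measure (Fin N → Fin d → ℝ)).restrict U) :=
      isFiniteMeasure_restrict.2 hUE.measure_lt_top.ne
    rw [integral_add (integrable_const _) ((integrable_const _).indicator hBm),
      integral_indicator_const _ hBm]
    have h1 : ((volume : Measure (Fin N → Fin d → ℝ)).restrict U).real B ≤ 2 * δ := by
      refine le_trans ?_ hBr
      refine ENNReal.toReal_mono ?_ (Measure.restrict_apply_le _ _)
      exact (hBv.trans_lt (by simp)).ne
    have h2 : ∫ _ in U, (C * ε₁ ^ p) ∂(volume : Measure (Fin N → Fin d → ℝ)) =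
        V * (C * ε₁ ^ p) := by
      exact setIntegral_const (E := ℝ) (X := Fin N → Fin d → ℝ) _
    rw [h2, smul_eq_mul]
    gcongr
  have hlt : V * (C * ε₁ ^ p) + 2 * δ * K < e₀ := by
    rw [hε₁p]
    have h1 : V * (C * (e₀ / (2 * (C * V + 1)))) ≤ e₀ / 2 := by
      have hCV : 0 ≤ C * V := by positivity
      rw [← mul_assoc, ← mul_div_assoc, div_le_div_iff₀ (by positivity) (by positivity)]
      nlinarith
    have h2 : 2 * δ * K ≤ e₀ / 4 := by
      simp only [δ]
      rw [← mul_div_assoc, div_mul_eq_mul_div, div_le_div_iff₀ (by positivity) (by positivity)]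
      nlinarith
    linarith
  have hI : 0 ≤ ∫ X in U, ∑ i : Fin N, ∑ j : Fin d, |f X i j - T X i j| ^ p
      ∂(volume : Measure (Fin N → Fin d → ℝ)) :=
    integral_nonneg fun X => Finset.sum_nonneg fun i _ => Finset.sum_nonneg fun j _ => by positivity
  calc _ < e₀ ^ (1 / p) :=
        Real.rpow_lt_rpow hI ((hbound.trans hval).trans_lt hlt) (by positivity)
    _ = ε := by
        rw [← Real.rpow_mul hε.le, mul_one_div_cancel hp0.ne', Real.rpow_one]
end

section
/- k-MIP Approximation Theorem: fix N, d ≥ 1, h, m, r ≥ 1, and k with 1 ≤ k ≤ N. For every full-attention transformer T_full ∈ 𝒯_full^{h,m,r}, every real ε > 0, every real p with 1 ≤ p < ∞, and every compact set U ⊆ Matrix (Fin N) (Fin d) ℝ, there exists a k-MIP transformer T_{k-MIP} ∈ 𝒯_{k-MIP}^{2,1,4} such that (∫_U ‖T_{k-MIP}(X) − T_full(X)‖_p^p dX)^{1/p} < ε, where the integral is with respect to Lebesgue measure on Matrix (Fin N) (Fin d) ℝ ≅ ℝ^{N·d} and ‖Y‖_p = (∑_{i,j} |Y i j|^p)^{1/p}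 is the entrywise ℓ^p norm. -/
open Matrix MeasureTheory

/-- Row-wise softmax of the scaled score matrix `S` with scaling `1 / √m`. -/
noncomputable def softmaxRows {N : ℕ} (m : ℕ) (S : Matrix (Fin N) (Fin N) ℝ) :
    Matrix (Fin N) (Fin N) ℝ :=
  Matrix.of fun i j =>
    Real.exp (S i j / Real.sqrt m) / ∑ j' : Fin N, Real.exp (S i j' / Real.sqrt m)

/-- The full multi-head self-attention layer:
`Attn(X) = ∑ₕ softmax(S^h(X) / √m) (X Wv^h) Wo^h`. -/
noncomputable def fullAttn {N d m H : ℕ}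
    (WQ WK WV : Fin H → Matrix (Fin d) (Fin m) ℝ)
    (WO : Fin H → Matrix (Fin m) (Fin d) ℝ)
    (X : Matrix (Fin N) (Fin d) ℝ) : Matrix (Fin N) (Fin d) ℝ :=
  ∑ h : Fin H, softmaxRows m (scores (WQ h) (WK h) X) * (X * WV h) * WO h

/-- A full-attention transformer block: `X ↦ Z + MLP(Z)` where `Z = X + Attn(X)`. -/
noncomputable def fullBlock {N d m H r : ℕ}
    (WQ WK WV : Fin H → Matrix (Fin d) (Fin m) ℝ)
    (WO : Fin H → Matrix (Fin m) (Fin d) ℝ)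
    (W₁ : Matrix (Fin d) (Fin r) ℝ) (b₁ : Fin r → ℝ)
    (W₂ : Matrix (Fin r) (Fin d) ℝ) (b₂ : Fin d → ℝ)
    (X : Matrix (Fin N) (Fin d) ℝ) : Matrix (Fin N) (Fin d) ℝ :=
  X + fullAttn WQ WK WV WO X +
    mlp W₁ b₁ W₂ b₂ (X + fullAttn WQ WK WV WO X)

/-- The class `𝒯_full^{H,m,r}`: all finite compositions of full-attention
transformer blocks (over all choices of weights). -/
inductive IsFullTransformer (N d H m r : ℕ) :
    (Matrix (Fin N) (Fin d) ℝ → Matrix (Fin N) (Fin d) ℝ) → Prop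
  | single (WQ WK WV : Fin H → Matrix (Fin d) (Fin m) ℝ)
      (WO : Fin H → Matrix (Fin m) (Fin d) ℝ)
      (W₁ : Matrix (Fin d) (Fin r) ℝ) (b₁ : Fin r → ℝ)
      (W₂ : Matrix (Fin r) (Fin d) ℝ) (b₂ : Fin d → ℝ) :
      IsFullTransformer N d H m r (fullBlock WQ WK WV WO W₁ b₁ W₂ b₂)
  | comp (WQ WK WV : Fin H → Matrix (Fin d) (Fin m) ℝ)
      (WO : Fin H → Matrix (Fin m) (Fin d) ℝ)
      (W₁ : Matrix (Fin d) (Fin r) ℝ) (b₁ : Fin r → ℝ)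
      (W₂ : Matrix (Fin r) (Fin d) ℝ) (b₂ : Fin d → ℝ)
      {T : Matrix (Fin N) (Fin d) ℝ → Matrix (Fin N) (Fin d) ℝ}
      (hT : IsFullTransformer N d H m r T) :
      IsFullTransformer N d H m r (fun X => fullBlock WQ WK WV WO W₁ b₁ W₂ b₂ (T X))

open Filter Topology

namespace KMIP

abbrev Mat (N d : ℕ) := Matrix (Fin N) (Fin d) ℝ

variable {N d k : ℕ}

/-- four-unit ReLU functions -/
def phi (α β γ : Fin 4 → ℝ) (t : ℝ) : ℝ := ∑ i, α i * max 0 (β i * t + γ i)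

/-- tokenwise rank-one residual layer -/
def layer (w v : Fin d → ℝ) (φ : ℝ → ℝ) (X : Mat N d) : Mat N d :=
  fun a j => X a j + φ (∑ l, X a l * w l) * v j

theorem layer_isKMIP (w v : Fin d → ℝ) (α β γ : Fin 4 → ℝ) :
    IsKMIPTransformer N d k 2 1 4 (layer w v (phi α β γ)) := by
  have := IsKMIPTransformer.single (N := N) (d := d) (k := k) (H := 2) (m := 1) (r := 4)
    0 0 0 0 (Matrix.of fun l i => w l * β i) γ (Matrix.of fun i j => α i * v j) 0
  convert this using 1
  funext X
  ext a j
  have h0 : kMIPAttn (N := N) (d := d) (m := 1) (H := 2) k 0 0 0 0 X = 0 := by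
    simp [kMIPAttn]
  rw [kMIPBlock, h0]
  simp only [layer, phi, mlp, add_zero, Matrix.add_apply, Matrix.mul_apply, Matrix.of_apply,
    Pi.zero_apply, Finset.sum_mul]
  congr 1
  refine Finset.sum_congr rfl fun i _ => ?_
  rw [Finset.mul_sum]
  have : ∑ l, β i * (X a l * w l) = ∑ l, X a l * (w l * β i) :=
    Finset.sum_congr rfl fun l _ => by ring
  rw [this]; ring

theorem comp_isKMIP {T T' : Mat N d → Mat N d} (h' : IsKMIPTransformer N d k 2 1 4 T')
    (h : IsKMIPTransformer N d k 2 1 4 T) :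
    IsKMIPTransformer N d k 2 1 4 (fun X => T' (T X)) := by
  induction h' with
  | single WQ WK WV WO W₁ b₁ W₂ b₂ => exact .comp WQ WK WV WO W₁ b₁ W₂ b₂ h
  | comp WQ WK WV WO W₁ b₁ W₂ b₂ hT ih => exact .comp WQ WK WV WO W₁ b₁ W₂ b₂ ih

theorem id_isKMIP : IsKMIPTransformer N d k 2 1 4 (fun X => X) := by
  convert layer_isKMIP (N := N) (d := d) (k := k) 0 0 0 0 0 using 1
  funext X
  ext a j
  simp [layer]

theorem phi_cont (α β γ : Fin 4 → ℝ) : Continuous (phi α β γ) := by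
  unfold phi; fun_prop

theorem layer_cont (w v : Fin d → ℝ) {φ : ℝ → ℝ} (h : Continuous φ) :
    Continuous (layer (N := N) w v φ) := by
  unfold layer
  refine continuous_pi fun a => continuous_pi fun j => ?_
  have h1 : ∀ l, Continuous fun X : Mat N d => X a l := fun l =>
    (continuous_apply l).comp (continuous_apply a)
  refine (h1 j).add ((h.comp (continuous_finsetSum _ fun l _ => (h1 l).mul continuous_const)).mul
    continuous_const)

/-- asymptotic realizability with continuous convergence -/
def Appr (k : ℕ) (F : Mat N d → Mat N d) (G : Set (Mat N d)) : Prop :=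
  ∃ T : ℕ → Mat N d → Mat N d, (∀ n, IsKMIPTransformer N d k 2 1 4 (T n)) ∧
    ∀ X ∈ G, Tendsto (fun p : ℕ × Mat N d => T p.1 p.2) (atTop ×ˢ 𝓝 X) (𝓝 (F X))

theorem Appr.comp {F F' : Mat N d → Mat N d} {G G' : Set (Mat N d)}
    (h' : Appr k F' G') (h : Appr k F G) (hm : ∀ X ∈ G, F X ∈ G') :
    Appr k (fun X => F' (F X)) G := by
  obtain ⟨T', hT', hl'⟩ := h'
  obtain ⟨T, hT, hl⟩ := h
  refine ⟨fun n X => T' n (T n X), fun n => comp_isKMIP (hT' n) (hT n), fun X hX => ?_⟩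
  exact (hl' _ (hm X hX)).comp (tendsto_fst.prodMk (hl X hX))

theorem Appr.congr {F F' : Mat N d → Mat N d} {G : Set (Mat N d)}
    (h : Appr k F G) (he : ∀ X ∈ G, F X = F' X) : Appr k F' G := by
  obtain ⟨T, hT, hl⟩ := h
  exact ⟨T, hT, fun X hX => he X hX ▸ hl X hX⟩

theorem Appr.of_cont {F : Mat N d → Mat N d} (h : IsKMIPTransformer N d k 2 1 4 F)
    (hc : Continuous F) (G : Set (Mat N d)) : Appr k F G :=
  ⟨fun _ => F, fun _ => h, fun X _ => (hc.tendsto X).comp tendsto_snd⟩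

/-! ### Tokenwise memorization -/

theorem exists_bump (C : Finset ℝ) (c : ℝ) (hc : c ∉ C) :
    ∃ α β γ : Fin 4 → ℝ, phi α β γ c = 1 ∧ ∀ t ∈ C, phi α β γ t = 0 := by
  obtain ⟨η, hη, hC⟩ : ∃ η > 0, ∀ t ∈ C, η ≤ |t - c| := by
    induction C using Finset.induction_on with
    | empty => exact ⟨1, one_pos, by simp⟩
    | insert t C _ ih =>
      simp only [Finset.mem_insert, not_or] at hc
      obtain ⟨η, hη, h⟩ := ih hc.2
      refine ⟨min η |t - c|, lt_min hη (abs_pos.2 (sub_ne_zero.2 (Ne.symm hc.1))), ?_⟩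
      intro s hs
      rcases Finset.mem_insert.1 hs with rfl | hs
      · exact min_le_right _ _
      · exact (min_le_left _ _).trans (h s hs)
  refine ⟨![1/η, -2/η, 1/η, 0], ![1, 1, 1, 0], ![-c+η, -c, -c-η, 0], ?_, ?_⟩
  · simp only [phi, Fin.sum_univ_four]
    simp
    rw [max_eq_right hη.le, max_eq_left (by linarith)]
    field_simp
    simp
  · intro t ht
    have := hC t ht
    simp only [phi, Fin.sum_univ_four]
    simp
    rcases le_abs'.1 this with h | h
    · rw [max_eq_left (by linarith), max_eq_left (by linarith), max_eq_left (by linarith)]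
      simp
    · rw [max_eq_right (by linarith), max_eq_right (by linarith), max_eq_right (by linarith)]
      field_simp
      ring

/-- tokenwise continuous realizable maps -/
def Tok (N k : ℕ) (τ : (Fin d → ℝ) → (Fin d → ℝ)) : Prop :=
  IsKMIPTransformer N d k 2 1 4 (fun X a => τ (X a)) ∧ Continuous τ

theorem Tok.comp {τ τ' : (Fin d → ℝ) → (Fin d → ℝ)} (h' : Tok N k τ') (h : Tok N k τ) :
    Tok N k (fun x => τ' (τ x)) :=
  ⟨comp_isKMIP h'.1 h.1, h'.2.comp h.2⟩

theorem Tok.layer (w v : Fin d → ℝ) (α β γ : Fin 4 → ℝ) :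
    Tok N k (fun x : Fin d → ℝ => x + phi α β γ (∑ l, x l * w l) • v) := by
  refine ⟨?_, ?_⟩
  · exact layer_isKMIP (N := N) (d := d) (k := k) w v α β γ
  · have := phi_cont α β γ
    fun_prop

theorem Tok.cont {τ : (Fin d → ℝ) → (Fin d → ℝ)} (h : Tok N k τ) :
    Continuous (fun X : Mat N d => (fun a => τ (X a) : Mat N d)) :=
  continuous_pi fun a => h.2.comp (continuous_apply a)

theorem exists_w (hd : 1 ≤ d) (P : Finset (Fin d → ℝ)) :
    ∃ w : Fin d → ℝ, w ≠ 0 ∧ ∀ x ∈ P, ∀ y ∈ P, (∑ l, x l * w l) = ∑ l, y l * w l → x = y := by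
  classical
  have : Nonempty (Fin d) := ⟨⟨0, hd⟩⟩
  let e : Fin d → ℝ := fun _ => 1
  have he : e ≠ 0 := fun h => by simpa [e] using congrFun h ⟨0, hd⟩
  let ι := Option {q : (Fin d → ℝ) × (Fin d → ℝ) // q ∈ P ×ˢ P ∧ q.1 ≠ q.2}
  let u : ι → (Fin d → ℝ) := fun o => o.elim e fun q => q.1.1 - q.1.2
  have hfin : Finite {q : (Fin d → ℝ) × (Fin d → ℝ) // q ∈ P ×ˢ P ∧ q.1 ≠ q.2} :=
    Set.Finite.to_subtype ((P ×ˢ P).finite_toSet.subset fun q hq => hq.1)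
  obtain ⟨f, hf⟩ := Module.exists_dual_forall_apply_ne_zero (K := ℝ) u (by
    rintro (_ | ⟨q, hq1, hq2⟩)
    · exact he
    · exact sub_ne_zero.2 hq2)
  have hfs : ∀ x : Fin d → ℝ, f x = ∑ l, x l * f (Pi.single l 1) := by
    intro x
    conv_lhs => rw [pi_eq_sum_univ' x]
    simp [map_sum]
  refine ⟨fun l => f (Pi.single l 1), ?_, ?_⟩
  · intro h
    apply hf none
    rw [hfs]
    exact Finset.sum_eq_zero fun l _ => by rw [congrFun h l]; simp
  · intro x hx y hy h
    by_contra hxy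
    apply hf (some ⟨(x, y), Finset.mk_mem_product hx hy, hxy⟩)
    change f (x - y) = 0
    rw [map_sub, hfs x, hfs y, h, sub_self]

theorem memorize (hd : 1 ≤ d) (P : Finset (Fin d → ℝ)) (g : (Fin d → ℝ) → (Fin d → ℝ)) :
    ∃ τ, Tok N k τ ∧ ∀ x ∈ P, τ x = g x := by
  classical
  obtain ⟨w, hw, hinj⟩ := exists_w hd P
  obtain ⟨v, hv⟩ : ∃ v : Fin d → ℝ, ∑ l, v l * w l = 1 := by
    obtain ⟨j, hj⟩ := Function.ne_iff.1 hw
    refine ⟨Pi.single j (w j)⁻¹, ?_⟩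
    rw [Finset.sum_eq_single j] <;> simp_all
  set D : (Fin d → ℝ) → ℝ := fun x => ∑ l, x l * w l with hD
  have Dadd : ∀ x s, D (x + s • v) = D x + s := by
    intro x s
    simp only [hD, Pi.add_apply, Pi.smul_apply, smul_eq_mul, add_mul, Finset.sum_add_distrib,
      mul_assoc, ← Finset.mul_sum, hv, mul_one]
  obtain ⟨s, hs⟩ : ∃ s : ℝ, s ∉ (P ×ˢ P).image (fun q => D (g q.2) - D q.1) :=
    Infinite.exists_notMem_finset _
  have hs' : ∀ x ∈ P, ∀ y ∈ P, D x + s ≠ D (g y) := by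
    intro x hx y hy h
    apply hs
    rw [Finset.mem_image]
    exact ⟨(x, y), Finset.mk_mem_product hx hy, by simp only; linarith⟩
  have key : ∀ A : Finset (Fin d → ℝ), A ⊆ P → ∃ τ, Tok N k τ ∧ (∀ x ∈ A, τ x = g x) ∧
      ∀ x ∈ P, x ∉ A → τ x = x + s • v := by
    intro A
    induction A using Finset.induction_on with
    | empty =>
      intro _
      refine ⟨_, Tok.layer 0 (s • v) ![1, 0, 0, 0] 0 ![1, 0, 0, 0], by simp, ?_⟩
      intro x _ _
      simp [phi, Fin.sum_univ_four]
    | insert p A hp ih =>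
      intro hA
      obtain ⟨τ, hτ, h1, h2⟩ := ih ((Finset.subset_insert _ _).trans hA)
      have hpP : p ∈ P := hA (Finset.mem_insert_self _ _)
      obtain ⟨α, β, γ, hb1, hb2⟩ := exists_bump (((P.erase p).image fun x => D (τ x))) (D p + s) (by
        rw [Finset.mem_image]
        rintro ⟨x, hx, he⟩
        obtain ⟨hxp, hxP⟩ := Finset.mem_erase.1 hx
        by_cases hxA : x ∈ A
        · rw [h1 x hxA] at he
          exact hs' p hpP x hxP he.symm
        · rw [h2 x hxP hxA, Dadd] at he
          exact hxp (hinj x hxP p hpP (by linarith)))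
      refine ⟨_, (Tok.layer w (g p - p - s • v) α β γ).comp hτ, ?_, ?_⟩
      · intro x hx
        rcases Finset.mem_insert.1 hx with rfl | hx'
        · have : (∑ l, τ x l * w l) = D x + s := by
            rw [h2 x hpP hp, ← Dadd]
          simp only [this, hb1]
          rw [h2 x hpP hp]
          simp
        · have hxp : x ≠ p := by rintro rfl; exact hp hx'
          have : phi α β γ (∑ l, τ x l * w l) = 0 :=
            hb2 _ (Finset.mem_image_of_mem (fun x => D (τ x)) (Finset.mem_erase.2 ⟨hxp, hA hx⟩))
          simp only [this]
          rw [h1 x hx']; simp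
      · intro x hxP hx
        simp only [Finset.mem_insert, not_or] at hx
        have : phi α β γ (∑ l, τ x l * w l) = 0 :=
            hb2 _ (Finset.mem_image_of_mem (fun x => D (τ x)) (Finset.mem_erase.2 ⟨hx.1, hxP⟩))
        simp only [this]
        rw [h2 x hxP hx.2]; simp
  obtain ⟨τ, hτ, h, _⟩ := key P subset_rfl
  exact ⟨τ, hτ, h⟩

/-! ### Hard attention as a limit -/

theorem mem_topk (hk : 1 ≤ k) (s : Fin N → ℝ) (i : Fin N) (h : ∀ b, b ≠ i → s b < s i) :
    i ∈ topkSet k s := by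
  simp only [topkSet, Finset.mem_filter, Finset.mem_univ, true_and]
  refine lt_of_eq_of_lt ?_ hk
  rw [Finset.card_eq_zero, Finset.filter_eq_empty_iff]
  intro b _ hb
  by_cases hbi : b = i
  · subst hbi
    rcases hb with hb | hb
    · exact lt_irrefl _ hb
    · exact lt_irrefl _ hb.2
  · have := h b hbi
    rcases hb with hb | hb
    · exact lt_asymm hb this
    · exact this.ne hb.1

theorem softmax_lim {ι : Type*} {l : Filter ι} (hk : 1 ≤ k) (s : ι → Fin N → ℝ) (i : Fin N)
    (h : ∀ b, b ≠ i → Tendsto (fun p => s p b - s p i) l atBot) (b : Fin N) :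
    Tendsto (fun p => (if b ∈ topkSet k (s p) then Real.exp (s p b) else 0) /
      ∑ b' ∈ topkSet k (s p), Real.exp (s p b')) l (𝓝 (if b = i then 1 else 0)) := by
  set num : ι → Fin N → ℝ := fun p b =>
    if b ∈ topkSet k (s p) then Real.exp (s p b - s p i) else 0 with hnum
  have hev : ∀ᶠ p in l, i ∈ topkSet k (s p) := by
    have : ∀ᶠ p in l, ∀ b, b ≠ i → s p b - s p i < 0 := by
      rw [eventually_all]
      intro b
      by_cases hb : b = i
      · simp [hb]
      · filter_upwards [(h b hb).eventually (eventually_lt_atBot 0)] with p hp _ using hp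
    filter_upwards [this] with p hp
    exact mem_topk hk _ _ fun b hb => by linarith [hp b hb]
  have hlim : ∀ b, Tendsto (fun p => num p b) l (𝓝 (if b = i then 1 else 0)) := by
    intro b
    by_cases hb : b = i
    · subst hb
      simp only [if_true]
      refine tendsto_const_nhds.congr' ?_
      filter_upwards [hev] with p hp
      simp [hnum, hp]
    · rw [if_neg hb]
      refine squeeze_zero (fun p => ?_) (fun p => ?_) (Real.tendsto_exp_atBot.comp (h b hb))
      · simp only [hnum]; split_ifs <;> positivity
      · simp only [hnum, Function.comp]; split_ifs <;> first | exact le_rfl | positivity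
  have hsum : Tendsto (fun p => ∑ b', num p b') l (𝓝 1) := by
    have := tendsto_finsetSum Finset.univ fun b' _ => hlim b'
    simpa using this
  have := (hlim b).div hsum one_ne_zero
  rw [div_one] at this
  refine this.congr fun p => ?_
  have h1 : ∀ b', num p b' =
      (if b' ∈ topkSet k (s p) then Real.exp (s p b') else 0) * Real.exp (-s p i) := by
    intro b'
    simp only [hnum, sub_eq_add_neg, Real.exp_add]
    split_ifs <;> simp
  have h2 : ∑ b', num p b' =
      (∑ b' ∈ topkSet k (s p), Real.exp (s p b')) * Real.exp (-s p i) := by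
    simp only [h1, ← Finset.sum_mul]
    congr 1
    rw [← Finset.sum_filter]
    simp
  simp only [Pi.div_apply]
  rw [h2, h1, mul_div_mul_right _ _ (Real.exp_pos _).ne']

theorem attn_appr (hk : 1 ≤ k) (j0 : Fin d) (K : ℝ) (G : Set (Mat N d)) (star : Mat N d → Fin N)
    (hpos : ∀ X ∈ G, ∀ a, 0 < X a j0) (hstar : ∀ X ∈ G, ∀ b, b ≠ star X → X b j0 < X (star X) j0) :
    Appr k (fun X a j => X a j + if j = j0 then K * X (star X) j0 else 0) G := by
  let WQ : ℕ → Fin 2 → Matrix (Fin d) (Fin 1) ℝ :=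
    fun n _ => Matrix.of fun l _ => if l = j0 then (n : ℝ) else 0
  let WK : Fin 2 → Matrix (Fin d) (Fin 1) ℝ :=
    fun _ => Matrix.of fun l _ => if l = j0 then 1 else 0
  let WO : Fin 2 → Matrix (Fin 1) (Fin d) ℝ :=
    fun _ => Matrix.of fun _ j => if j = j0 then K / 2 else 0
  refine ⟨fun n => kMIPBlock k (WQ n) WK WK WO 0 0 0 0, fun n => .single _ _ _ _ _ _ _ _, ?_⟩
  intro X hX
  have hsc : ∀ (p : ℕ × Mat N d) h, scores (WQ p.1 h) (WK h) p.2 =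
      fun a b => p.1 * (p.2 a j0 * p.2 b j0) := by
    intro p h
    ext a b
    simp [scores, Matrix.mul_apply, WQ, WK]
    ring
  have hval : ∀ (p : ℕ × Mat N d) (h : Fin 2) b x, (p.2 * WK h) b x = p.2 b j0 := by
    intro p h b x
    simp [Matrix.mul_apply, WK]
  have hform : ∀ (p : ℕ × Mat N d) a j, kMIPBlock (r := 4) k (WQ p.1) WK WK WO 0 0 0 0 p.2 a j =
      p.2 a j + (if j = j0 then K * ∑ b,
        ((if b ∈ topkSet k (fun b => p.1 * (p.2 a j0 * p.2 b j0)) then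
          Real.exp (p.1 * (p.2 a j0 * p.2 b j0)) else 0) /
        ∑ b' ∈ topkSet k (fun b => p.1 * (p.2 a j0 * p.2 b j0)),
          Real.exp (p.1 * (p.2 a j0 * p.2 b' j0))) * p.2 b j0 else 0) := by
    intro p a j
    simp only [kMIPBlock, mlp, kMIPAttn, hsc]
    simp [Matrix.add_apply, Matrix.mul_apply (M := Matrix.of _ ), Matrix.mul_apply, WO, WK]
    split_ifs <;> ring
  have hev : ∀ a j, Tendsto (fun p : ℕ × Mat N d => p.2 a j) (atTop ×ˢ 𝓝 X) (𝓝 (X a j)) := by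
    intro a j
    exact (((continuous_apply j).comp (continuous_apply a)).tendsto X).comp tendsto_snd
  refine tendsto_pi_nhds.2 fun a => tendsto_pi_nhds.2 fun j => ?_
  simp only [hform]
  refine (hev a j).add ?_
  split_ifs with hj
  · refine Tendsto.const_mul _ ?_
    have : X (star X) j0 = ∑ b, (if b = star X then 1 else 0) * X b j0 := by simp
    rw [this]
    refine tendsto_finsetSum _ fun b _ => Tendsto.mul ?_ (hev b j0)
    refine softmax_lim hk (fun (p : ℕ × Mat N d) b => p.1 * (p.2 a j0 * p.2 b j0)) (star X) ?_ b
    intro b hb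
    have h1 : Tendsto (fun p : ℕ × Mat N d => p.2 a j0 * (p.2 b j0 - p.2 (star X) j0))
        (atTop ×ˢ 𝓝 X) (𝓝 (X a j0 * (X b j0 - X (star X) j0))) :=
      (hev a j0).mul ((hev b j0).sub (hev _ j0))
    have h2 : X a j0 * (X b j0 - X (star X) j0) < 0 :=
      mul_neg_of_pos_of_neg (hpos X hX a) (by linarith [hstar X hX b hb])
    have h3 : Tendsto (fun p : ℕ × Mat N d => (p.1 : ℝ)) (atTop ×ˢ 𝓝 X) atTop :=
      tendsto_natCast_atTop_atTop.comp tendsto_fst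
    refine (h3.atTop_mul_neg h2 h1).congr fun p => ?_
    ring
  · exact tendsto_const_nhds

/-! ### Contextual mapping -/

/-- the token labelling `σ` can be realized with any encoding -/
def Realz (k : ℕ) {Lab : Type} (S : Set (Mat N d)) (σ : Mat N d → Fin N → Lab) : Prop :=
  ∀ e : Lab → (Fin d → ℝ), Appr k (fun X a => e (σ X a)) S

theorem Realz.init (hd : 1 ≤ d) {S : Set (Mat N d)} (hS : S.Finite) :
    Realz k S (fun X a => (X a, (∅ : Finset (Fin d → ℝ)))) := by
  classical
  intro e
  have hP : (⋃ X ∈ S, Set.range fun a => X a).Finite :=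
    hS.biUnion fun X _ => Set.finite_range _
  obtain ⟨τ, hτ, h⟩ := memorize (N := N) (k := k) hd hP.toFinset (fun x => e (x, ∅))
  refine (Appr.of_cont hτ.1 hτ.cont S).congr fun X hX => ?_
  funext a
  exact h _ (by simp only [Set.Finite.mem_toFinset, Set.mem_iUnion]; exact ⟨X, hX, a, rfl⟩)

theorem Realz.step {Lab Lab2 : Type} (hd : 1 ≤ d) (hk : 1 ≤ k) (hN : 1 ≤ N) {S : Set (Mat N d)}
    (hS : S.Finite) {σ : Mat N d → Fin N → Lab} (h : Realz k S σ) (low : Lab → Prop)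
    (hinj : ∀ X ∈ S, Function.Injective (σ X)) (hex : ∀ X ∈ S, ∃ a, ¬ low (σ X a)) :
    ∃ star : Mat N d → Fin N, (∀ X ∈ S, ¬ low (σ X (star X))) ∧
      ∀ q : Lab → Lab → Lab2, Realz k S fun X a => q (σ X a) (σ X (star X)) := by
  classical
  let j0 : Fin d := ⟨0, hd⟩
  have : Nonempty (Fin N) := ⟨⟨0, hN⟩⟩
  have hR : (⋃ X ∈ S, Set.range (σ X)).Finite := hS.biUnion fun X _ => Set.finite_range _
  have hmem : ∀ X ∈ S, ∀ a, σ X a ∈ (⋃ X ∈ S, Set.range (σ X)) := fun X hX a => by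
    simp only [Set.mem_iUnion]; exact ⟨X, hX, a, rfl⟩
  obtain ⟨ν, K0, hν, hνK⟩ : ∃ (ν : Lab → ℕ) (K0 : ℕ), Set.InjOn ν (⋃ X ∈ S, Set.range (σ X)) ∧
      ∀ s ∈ (⋃ X ∈ S, Set.range (σ X)), ν s < K0 := by
    obtain ⟨ν, hν⟩ := Set.countable_iff_exists_injOn.1 hR.countable
    obtain ⟨B, hB⟩ := (hR.image ν).bddAbove
    exact ⟨ν, B + 1, hν, fun s hs => Nat.lt_succ_of_le (hB (Set.mem_image_of_mem _ hs))⟩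
  let c : Lab → ℕ := fun s => 1 + ν s + if low s then 0 else K0
  have hc : ∀ s ∈ (⋃ X ∈ S, Set.range (σ X)), ∀ t ∈ (⋃ X ∈ S, Set.range (σ X)),
      c s = c t → s = t := by
    intro s hs t ht hst
    have h1 := hνK s hs
    have h2 := hνK t ht
    apply hν hs ht
    simp only [c] at hst
    split_ifs at hst <;> omega
  choose star hst using fun X : Mat N d => Finite.exists_max fun a => c (σ X a)
  refine ⟨star, ?_, ?_⟩
  · intro X hX hlow
    obtain ⟨a, ha⟩ := hex X hX
    have h1 := hst X a
    have h2 := hνK _ (hmem X hX (star X))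
    simp only [c, if_neg ha, if_pos hlow] at h1
    omega
  intro q e
  let E : Lab → (Fin d → ℝ) := fun s j => if j = j0 then (c s : ℝ) else 0
  let K : ℝ := ((2 * K0 + 1 : ℕ) : ℝ)
  let G : Set (Mat N d) := (fun X => (fun a => E (σ X a) : Mat N d)) '' S
  have hGstar : ∀ X ∈ S, ∀ b, b ≠ star X → c (σ X b) < c (σ X (star X)) := by
    intro X hX b hb
    refine lt_of_le_of_ne (hst X b) fun he => hb (hinj X hX (hc _ (hmem X hX _) _ (hmem X hX _) he))
  choose! starG hsG using fun (Y : Mat N d) (hY : Y ∈ G) =>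
    show ∃ i, ∀ b, b ≠ i → Y b j0 < Y i j0 by
      obtain ⟨X, hX, rfl⟩ := hY
      exact ⟨star X, fun b hb => by simpa [E] using hGstar X hX b hb⟩
  have hA := attn_appr hk j0 K G starG (by
    rintro _ ⟨X, hX, rfl⟩ a
    simp only [E, c, if_true]; positivity) hsG
  have hA2 := hA.comp (h E) (fun X hX => Set.mem_image_of_mem _ hX)
  have hA3 : Appr k (fun X a j => if j = j0 then (c (σ X a) : ℝ) + K * c (σ X (star X)) else 0) S := by
    refine hA2.congr fun X hX => ?_
    have hss : starG (fun a => E (σ X a)) = star X := by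
      by_contra hne
      have h1 := hsG (fun a => E (σ X a)) (Set.mem_image_of_mem _ hX) (star X) (Ne.symm hne)
      have h2 := hGstar X hX _ hne
      generalize starG (fun a => E (σ X a)) = i at h1 h2
      simp only [E, if_true] at h1
      exact absurd (Nat.cast_lt.1 h1) (by omega)
    funext a j
    simp only [hss, E]
    split_ifs <;> simp
  -- decode
  let R : Set (Fin d → ℝ) := ⋃ X ∈ S, Set.range fun a =>
    (fun j => if j = j0 then (c (σ X a) : ℝ) + K * c (σ X (star X)) else 0)
  have hRf : R.Finite := hS.biUnion fun X _ => Set.finite_range _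
  have hcK : ∀ X ∈ S, ∀ a, c (σ X a) < 2 * K0 + 1 := by
    intro X hX a
    have h2 := hνK _ (hmem X hX a)
    simp only [c]
    split_ifs <;> omega
  have hdec : ∃ g : (Fin d → ℝ) → (Fin d → ℝ), ∀ X ∈ S, ∀ a,
      g (fun j => if j = j0 then (c (σ X a) : ℝ) + K * c (σ X (star X)) else 0) =
        e (q (σ X a) (σ X (star X))) := by
    refine ⟨fun x => if hx : ∃ r : Mat N d × Fin N, r.1 ∈ S ∧ x =
      (fun j => if j = j0 then (c (σ r.1 r.2) : ℝ) + K * c (σ r.1 (star r.1)) else 0) then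
      e (q (σ hx.choose.1 hx.choose.2) (σ hx.choose.1 (star hx.choose.1))) else 0, ?_⟩
    intro X hX a
    have hx : ∃ r : Mat N d × Fin N, r.1 ∈ S ∧
      (fun j => if j = j0 then (c (σ X a) : ℝ) + K * c (σ X (star X)) else 0) =
      (fun j => if j = j0 then (c (σ r.1 r.2) : ℝ) + K * c (σ r.1 (star r.1)) else 0) :=
      ⟨(X, a), hX, rfl⟩
    simp only [dif_pos hx]
    obtain ⟨hY, he⟩ := hx.choose_spec
    generalize hx.choose = r at hY he
    obtain ⟨Y, b⟩ := r
    have he0 := congrFun he j0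
    simp only [if_true, K] at he0
    norm_cast at he0
    have b1 := hcK X hX a
    have b2 := hcK Y hY b
    have e1 : c (σ X a) = c (σ Y b) := by
      have := congrArg (· % (2 * K0 + 1)) he0
      simpa [Nat.add_mul_mod_self_left, Nat.mod_eq_of_lt b1, Nat.mod_eq_of_lt b2] using this
    have e2 : c (σ X (star X)) = c (σ Y (star Y)) := by
      rw [e1] at he0
      exact Nat.eq_of_mul_eq_mul_left (by omega) (Nat.add_left_cancel he0)
    rw [hc _ (hmem X hX _) _ (hmem Y hY _) e1, hc _ (hmem X hX _) _ (hmem Y hY _) e2]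
  obtain ⟨g, hg⟩ := hdec
  obtain ⟨τ, hτ, hτg⟩ := memorize (N := N) (k := k) hd hRf.toFinset g
  refine ((Appr.of_cont hτ.1 hτ.cont Set.univ).comp hA3 (fun _ _ => Set.mem_univ _)).congr ?_
  intro X hX
  funext a
  rw [← hg X hX a]
  exact hτg _ (by simp only [Set.Finite.mem_toFinset, R, Set.mem_iUnion]; exact ⟨X, hX, a, rfl⟩)

theorem context (hd : 1 ≤ d) (hk : 1 ≤ k) (hN : 1 ≤ N) {S : Set (Mat N d)}
    (hS : S.Finite) (hinj : ∀ X ∈ S, Function.Injective fun a => X a) (t : ℕ) (ht : t ≤ N) :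
    ∃ L : Mat N d → Finset (Fin d → ℝ), (∀ X ∈ S, (L X).card = t ∧ ∀ x ∈ L X, ∃ a, x = X a) ∧
      Realz k S (fun X a => (X a, L X)) := by
  classical
  induction t with
  | zero => exact ⟨fun _ => ∅, by simp, Realz.init hd hS⟩
  | succ t ih =>
    obtain ⟨L, hL, hR⟩ := ih (by omega)
    obtain ⟨star, h1, h2⟩ := hR.step (Lab2 := (Fin d → ℝ) × Finset (Fin d → ℝ)) hd hk hN hS
      (fun s => s.1 ∈ s.2) (fun X hX a b hab => hinj X hX (Prod.ext_iff.1 hab).1) (by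
        intro X hX
        by_contra! hcon
        have : (Finset.univ.image fun a => X a) ⊆ L X := by
          intro x hx
          obtain ⟨a, _, rfl⟩ := Finset.mem_image.1 hx
          exact hcon a
        have := Finset.card_le_card this
        rw [Finset.card_image_of_injective _ (hinj X hX), (hL X hX).1] at this
        simp at this
        omega)
    refine ⟨fun X => insert (X (star X)) (L X), ?_, h2 fun s s' => (s.1, insert s'.1 s.2)⟩
    intro X hX
    refine ⟨by rw [Finset.card_insert_of_notMem (h1 X hX), (hL X hX).1], ?_⟩
    intro x hx
    rcases Finset.mem_insert.1 hx with rfl | hx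
    · exact ⟨_, rfl⟩
    · exact (hL X hX).2 x hx

theorem finite_appr (hd : 1 ≤ d) (hk : 1 ≤ k) (hN : 1 ≤ N) {S : Set (Mat N d)}
    (hS : S.Finite) (hinj : ∀ X ∈ S, Function.Injective fun a => X a) (f : Mat N d → Mat N d)
    (hf : ∀ (σ : Equiv.Perm (Fin N)) (X : Mat N d), f (fun a => X (σ a)) = fun a => f X (σ a)) :
    Appr k f S := by
  classical
  obtain ⟨L, hL, hR⟩ := context (k := k) hd hk hN hS hinj N le_rfl
  have hLim : ∀ X ∈ S, L X = Finset.univ.image fun a => X a := by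
    intro X hX
    refine Finset.eq_of_subset_of_card_le ?_ ?_
    · intro x hx
      obtain ⟨a, rfl⟩ := (hL X hX).2 x hx
      exact Finset.mem_image_of_mem _ (Finset.mem_univ _)
    · rw [(hL X hX).1, Finset.card_image_of_injective _ (hinj X hX)]; simp
  have key : ∀ X ∈ S, ∀ Y ∈ S, ∀ a b, X a = Y b → L X = L Y → f X a = f Y b := by
    intro X hX Y hY a b hab hXY
    have h1 : ∀ c, ∃ c', X c' = Y c := by
      intro c
      have : Y c ∈ L X := by
        rw [hXY, hLim Y hY]; exact Finset.mem_image_of_mem _ (Finset.mem_univ _)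
      rw [hLim X hX] at this
      obtain ⟨c', _, h⟩ := Finset.mem_image.1 this
      exact ⟨c', h⟩
    choose π hπ using h1
    have hπi : Function.Injective π := by
      intro c c' h
      apply hinj Y hY
      simp only [← hπ, h]
    let σ : Equiv.Perm (Fin N) := Equiv.ofBijective π (Finite.injective_iff_bijective.1 hπi)
    have hY' : (fun a => X (σ a)) = Y := funext hπ
    have := congrFun (hf σ X) b
    rw [hY'] at this
    rw [this]
    have : σ b = a := hinj X hX (by
      change X (π b) = X a
      rw [hπ, hab])
    rw [this]
  refine (hR fun s => if hs : ∃ r : Mat N d × Fin N, r.1 ∈ S ∧ r.1 r.2 = s.1 ∧ L r.1 = s.2 then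
    f hs.choose.1 hs.choose.2 else 0).congr fun X hX => ?_
  funext a
  have hs : ∃ r : Mat N d × Fin N, r.1 ∈ S ∧ r.1 r.2 = X a ∧ L r.1 = L X := ⟨(X, a), hX, rfl, rfl⟩
  simp only [dif_pos hs]
  obtain ⟨h1, h2, h3⟩ := hs.choose_spec
  exact key _ h1 _ hX _ _ h2 h3

/-! ### Clipping -/

theorem exists_clip (M : ℝ) (hM : 0 ≤ M) (J : Finset (Fin d)) :
    ∃ τ : (Fin d → ℝ) → (Fin d → ℝ), Tok N k τ ∧ ∀ x j, τ x j =
      if j ∈ J then max (-M) (min M (x j)) else x j := by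
  classical
  induction J using Finset.induction_on with
  | empty => exact ⟨fun x => x, ⟨id_isKMIP, continuous_id⟩, by simp⟩
  | insert j0 J hj ih =>
    obtain ⟨τ, hτ, h⟩ := ih
    refine ⟨_, (Tok.layer (Pi.single j0 1) (Pi.single j0 1) ![-1, 1, 0, 0] ![1, -1, 0, 0]
      ![-M, -M, 0, 0]).comp hτ, ?_⟩
    intro x j
    have h1 : ∑ l, τ x l * (Pi.single j0 1 : Fin d → ℝ) l = x j0 := by
      rw [Finset.sum_eq_single j0]
      · simp [h, hj]
      · intro b _ hb; simp [hb]
      · simp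
    simp only [h1]
    simp only [Pi.add_apply, Pi.smul_apply, h]
    by_cases hjj : j = j0
    · subst hjj
      simp [hj, phi, Fin.sum_univ_four]
      rcases le_total (x j) M with h2 | h2 <;> rcases le_total (-M) (x j) with h3 | h3
      · rw [max_eq_left (by linarith), max_eq_left (by linarith), min_eq_right h2, max_eq_right h3]
        ring
      · rw [max_eq_left (by linarith), max_eq_right (by linarith), min_eq_right h2, max_eq_left h3]
        ring
      · rw [max_eq_right (by linarith), max_eq_left (by linarith), min_eq_left h2,
          max_eq_right (by linarith)]
        ring
      · rw [max_eq_right (by linarith), max_eq_right (by linarith), min_eq_left h2,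
          max_eq_right (by linarith)]
        linarith
    · simp [hjj]

/-! ### Quantization -/

noncomputable def quant (Q : ℝ) (t : ℝ) : ℝ := ((⌊t * Q⌋ : ℝ) + 1 / 2) / Q

def Gd (Q : ℝ) : Set (Mat N d) := {X | ∀ a j, ∀ z : ℤ, X a j * Q ≠ z}

theorem quant_mul {Q : ℝ} (hQ : 0 < Q) (t : ℝ) : quant Q t * Q = (⌊t * Q⌋ : ℝ) + 1 / 2 := by
  unfold quant; field_simp

theorem half_ne (i z : ℤ) : (i : ℝ) + 1 / 2 ≠ z := by
  intro h
  have : (2 * i + 1 : ℝ) = 2 * z := by linarith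
  norm_cast at this
  omega

theorem floor_quant {Q : ℝ} (hQ : 0 < Q) (t : ℝ) : ⌊quant Q t * Q⌋ = ⌊t * Q⌋ := by
  rw [quant_mul hQ, Int.floor_eq_iff]
  constructor <;> linarith

noncomputable def cellA (n : ℕ) (Q : ℝ) : Fin 4 → ℝ :=
  ![n / Q, -(n + 1) / Q, (n + 1) / Q, -n / Q]
noncomputable def cellC (n : ℕ) (i : ℤ) : Fin 4 → ℝ :=
  ![-i, -i - 1 / (2 * (n + 1)), -i - 1 + 1 / (2 * (n + 1)), -i - 1]

theorem cell_phi (n : ℕ) (Q : ℝ) (i : ℤ) (t : ℝ) :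
    phi (cellA n Q) (fun _ => Q) (cellC n i) t =
      (n * max 0 (Q * t - i) - (n + 1) * max 0 (Q * t - i - 1 / (2 * (n + 1))) +
       (n + 1) * max 0 (Q * t - i - 1 + 1 / (2 * (n + 1))) - n * max 0 (Q * t - i - 1)) / Q := by
  simp only [phi, Fin.sum_univ_four, cellA, cellC]
  simp
  have e1 : Q * t + (-(i : ℝ) - ((n : ℝ) + 1)⁻¹ * 2⁻¹) = Q * t - i - ((n : ℝ) + 1)⁻¹ * 2⁻¹ := by ring
  have e2 : Q * t + (-(i : ℝ) - 1 + ((n : ℝ) + 1)⁻¹ * 2⁻¹) =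
    Q * t - i - 1 + ((n : ℝ) + 1)⁻¹ * 2⁻¹ := by ring
  have e3 : Q * t + (-(i : ℝ) - 1) = Q * t - i - 1 := by ring
  have e4 : Q * t + -(i : ℝ) = Q * t - i := by ring
  rw [e1, e2, e3]
  ring

theorem cell_lim {Q : ℝ} (hQ : 0 < Q) (i : ℤ) (t : ℝ) (ht : ∀ z : ℤ, t * Q ≠ z) :
    Tendsto (fun p : ℕ × ℝ => phi (cellA p.1 Q) (fun _ => Q) (cellC p.1 i) p.2)
      (atTop ×ˢ 𝓝 t) (𝓝 ((if ⌊t * Q⌋ = i then quant Q t else t) - t)) := by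
  have hη : ∀ n : ℕ, (0 : ℝ) < 1 / (2 * (n + 1)) ∧ (1 : ℝ) / (2 * (n + 1)) ≤ 1 / 2 := by
    intro n
    refine ⟨by positivity, ?_⟩
    apply one_div_le_one_div_of_le <;> linarith [(Nat.cast_nonneg n : (0 : ℝ) ≤ n)]
  have hx : Tendsto (fun p : ℕ × ℝ => Q * p.2 - i) (atTop ×ˢ 𝓝 t) (𝓝 (Q * t - i)) :=
    (tendsto_snd.const_mul Q).sub_const _
  have hη0 : Tendsto (fun p : ℕ × ℝ => (1 : ℝ) / (2 * (p.1 + 1))) (atTop ×ˢ 𝓝 t) (𝓝 0) := by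
    have : Tendsto (fun n : ℕ => (1 : ℝ) / (2 * (n + 1))) atTop (𝓝 0) := by
      have := (tendsto_one_div_add_atTop_nhds_zero_nat (𝕜 := ℝ)).const_mul (1 / 2)
      rw [mul_zero] at this
      refine this.congr fun n => ?_
      have : (n : ℝ) + 1 ≠ 0 := by positivity
      field_simp
    exact this.comp tendsto_fst
  rcases lt_trichotomy ⌊t * Q⌋ i with h | h | h
  · have h' : Q * t - i < 0 := by
      have := (Int.floor_lt.1 h); linarith
    rw [if_neg h.ne, sub_self]
    refine tendsto_const_nhds.congr' ?_
    filter_upwards [hx.eventually (eventually_lt_nhds h')] with p hp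
    have := hη p.1
    rw [cell_phi, max_eq_left (by linarith), max_eq_left (by linarith), max_eq_left (by linarith),
      max_eq_left (by linarith)]
    simp
  · rw [if_pos h]
    have h1 : (0 : ℝ) < Q * t - i := by
      have := Int.floor_le (t * Q)
      rw [h] at this
      have := lt_of_le_of_ne this (Ne.symm (ht i))
      linarith
    have h2 : Q * t - i < 1 := by
      have := Int.lt_floor_add_one (t * Q)
      rw [h] at this; linarith
    have hl : Tendsto (fun p : ℕ × ℝ => quant Q t - p.2) (atTop ×ˢ 𝓝 t) (𝓝 (quant Q t - t)) :=
      tendsto_const_nhds.sub tendsto_snd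
    refine hl.congr' ?_
    have ev1 := (hx.sub hη0).eventually (eventually_gt_nhds (show (0 : ℝ) < Q * t - i - 0 by linarith))
    have ev2 := (hx.add hη0).eventually (eventually_lt_nhds (show Q * t - i + 0 < 1 by linarith))
    filter_upwards [ev1, ev2] with p hp1 hp2
    have := hη p.1
    rw [cell_phi, max_eq_right (by linarith), max_eq_right (by linarith), max_eq_left (by linarith),
      max_eq_left (by linarith), quant, h]
    have : (p.1 : ℝ) + 1 ≠ 0 := by positivity
    field_simp
    ring
  · have h' : 1 < Q * t - i := by
      have h3 : ((i + 1 : ℤ) : ℝ) ≤ t * Q := Int.le_floor.1 h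
      have := lt_of_le_of_ne h3 (Ne.symm (ht _))
      push_cast at this
      linarith
    rw [if_neg h.ne', sub_self]
    refine tendsto_const_nhds.congr' ?_
    filter_upwards [hx.eventually (eventually_gt_nhds h')] with p hp
    have := hη p.1
    rw [cell_phi, max_eq_right (by linarith), max_eq_right (by linarith),
      max_eq_right (by linarith), max_eq_right (by linarith)]
    have : (p.1 : ℝ) + 1 ≠ 0 := by positivity
    field_simp
    ring

theorem cell_appr {Q : ℝ} (hQ : 0 < Q) (j0 : Fin d) (i : ℤ) :
    Appr (N := N) k (fun X a j => if j = j0 ∧ ⌊X a j * Q⌋ = i then quant Q (X a j) else X a j)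
      (Gd Q) := by
  classical
  refine ⟨fun n => layer (Pi.single j0 1) (Pi.single j0 1) (phi (cellA n Q) (fun _ => Q) (cellC n i)),
    fun n => layer_isKMIP _ _ _ _ _, fun X hX => ?_⟩
  have hev : ∀ a j, Tendsto (fun p : ℕ × Mat N d => p.2 a j) (atTop ×ˢ 𝓝 X) (𝓝 (X a j)) := by
    intro a j
    exact (((continuous_apply j).comp (continuous_apply a)).tendsto X).comp tendsto_snd
  refine tendsto_pi_nhds.2 fun a => tendsto_pi_nhds.2 fun j => ?_
  have hs : ∀ p : ℕ × Mat N d, ∑ l, p.2 a l * (Pi.single j0 1 : Fin d → ℝ) l = p.2 a j0 := by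
    intro p
    rw [Finset.sum_eq_single j0]
    · simp
    · intro b _ hb; simp [hb]
    · simp
  simp only [layer, hs]
  by_cases hj : j = j0
  · subst hj
    simp only [Pi.single_eq_same, mul_one, true_and]
    have h1 := (cell_lim hQ i (X a j) (hX a j)).comp
      (tendsto_fst.prodMk (hev a j))
    have h2 := (hev a j).add h1
    rw [add_sub_cancel] at h2
    exact h2
  · simp only [hj, false_and, if_false, ne_eq, not_false_eq_true, Pi.single_eq_of_ne, mul_zero,
      add_zero]
    exact hev a j

theorem quant_appr {Q : ℝ} (hQ : 0 < Q) (C : Finset (Fin d × ℤ)) :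
    Appr (N := N) k (fun X a j => if (j, ⌊X a j * Q⌋) ∈ C then quant Q (X a j) else X a j)
      (Gd Q) := by
  classical
  induction C using Finset.induction_on with
  | empty => exact (Appr.of_cont id_isKMIP continuous_id _).congr (by simp)
  | insert c C hc ih =>
    obtain ⟨j0, i⟩ := c
    refine ((cell_appr (N := N) (k := k) hQ j0 i).comp ih ?_).congr ?_
    · intro X hX a j z
      simp only
      split_ifs
      · rw [quant_mul hQ]; exact half_ne _ _
      · exact hX a j z
    · intro X hX
      funext a j
      have hfl : ⌊(if (j, ⌊X a j * Q⌋) ∈ C then quant Q (X a j) else X a j) * Q⌋ = ⌊X a j * Q⌋ := by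
        split_ifs
        · exact floor_quant hQ _
        · rfl
      have hqq : quant Q (quant Q (X a j)) = quant Q (X a j) := by
        rw [quant, floor_quant hQ, quant]
      simp only [hfl, Finset.mem_insert, Prod.mk.injEq]
      by_cases h2 : (j, ⌊X a j * Q⌋) ∈ C
      · rw [if_pos h2, if_pos (Or.inr h2), hqq, ite_self]
      · rw [if_neg h2]
        by_cases h1 : j = j0 ∧ ⌊X a j * Q⌋ = i
        · rw [if_pos h1, if_pos (Or.inl h1)]
        · rw [if_neg h1, if_neg (not_or.2 ⟨h1, h2⟩)]

theorem main_appr (hd : 1 ≤ d) (hk : 1 ≤ k) (hN : 1 ≤ N) (f : Mat N d → Mat N d)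
    (hf : ∀ (σ : Equiv.Perm (Fin N)) (X : Mat N d), f (fun a => X (σ a)) = fun a => f X (σ a))
    {Q : ℝ} (hQ : 0 < Q) (B M : ℝ) (hM : 0 ≤ M) :
    ∃ T : ℕ → Mat N d → Mat N d, (∀ n, IsKMIPTransformer N d k 2 1 4 (T n)) ∧
      (∀ n X a j, |T n X a j| ≤ M) ∧
      ∀ X ∈ Gd Q, (∀ a j, |X a j| ≤ B) →
        (Function.Injective fun a => (fun j => quant Q (X a j) : Fin d → ℝ)) →
        (∀ a j, |f (fun a j => quant Q (X a j)) a j| ≤ M) →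
        Tendsto (fun n => T n X) atTop (𝓝 (f (fun a j => quant Q (X a j)))) := by
  classical
  let I : Finset ℤ := Finset.Icc ⌊-B * Q⌋ ⌊B * Q⌋
  let V : Set ℝ := (fun i : ℤ => ((i : ℝ) + 1 / 2) / Q) '' (I : Set ℤ)
  have hV : V.Finite := (I.finite_toSet).image _
  let S : Set (Mat N d) := {Y | (∀ a j, Y a j ∈ V) ∧ Function.Injective fun a => Y a}
  have hS : S.Finite := by
    have : {Y : Fin N → Fin d → ℝ | ∀ a, Y a ∈ {y : Fin d → ℝ | ∀ j, y j ∈ V}}.Finite :=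
      Set.Finite.pi' fun _ => Set.Finite.pi' fun _ => hV
    exact this.subset fun Y hY a j => hY.1 a j
  let G : Set (Mat N d) := {X | X ∈ Gd Q ∧ (∀ a j, |X a j| ≤ B) ∧
    Function.Injective fun a => (fun j => quant Q (X a j) : Fin d → ℝ)}
  have hin : ∀ t : ℝ, |t| ≤ B → ⌊t * Q⌋ ∈ I := by
    intro t ht
    have := abs_le.1 ht
    rw [Finset.mem_Icc]
    constructor <;> apply Int.floor_le_floor <;> apply mul_le_mul_of_nonneg_right _ hQ.le
    · exact this.1
    · exact this.2
  have h1 : Appr (N := N) k (fun X a j => quant Q (X a j)) G := by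
    obtain ⟨T, hT, hl⟩ := quant_appr (N := N) (d := d) (k := k) hQ (Finset.univ ×ˢ I)
    refine Appr.congr ⟨T, hT, fun X hX => hl X hX.1⟩ fun X hX => ?_
    funext a j
    have : (j, ⌊X a j * Q⌋) ∈ Finset.univ ×ˢ I :=
      Finset.mk_mem_product (Finset.mem_univ _) (hin _ (hX.2.1 a j))
    simp only [this, if_true]
  have h2 := (finite_appr (k := k) hd hk hN hS (fun X hX => hX.2) f hf).comp h1 (by
    intro X hX
    refine ⟨fun a j => ⟨⌊X a j * Q⌋, hin _ (hX.2.1 a j), rfl⟩, hX.2.2⟩)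
  obtain ⟨T, hT, hl⟩ := h2
  obtain ⟨τ, hτ, hc⟩ := exists_clip (N := N) (k := k) M hM (Finset.univ : Finset (Fin d))
  refine ⟨fun n X a => τ (T n X a), fun n => comp_isKMIP hτ.1 (hT n), ?_, ?_⟩
  · intro n X a j
    change |τ (T n X a) j| ≤ M
    rw [hc, if_pos (Finset.mem_univ _), abs_le]
    exact ⟨le_max_left _ _, max_le (by linarith) (min_le_left _ _)⟩
  · intro X h3 h4 h5 h6
    have h7 : Tendsto (fun n => T n X) atTop (𝓝 (f (fun a j => quant Q (X a j)))) :=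
      (hl X ⟨h3, h4, h5⟩).comp (tendsto_id.prodMk tendsto_const_nhds)
    have h8 := (hτ.cont.tendsto (f (fun a j => quant Q (X a j)))).comp h7
    have h9 : (fun a => τ (f (fun a j => quant Q (X a j)) a)) = f (fun a j => quant Q (X a j)) := by
      funext a j
      rw [hc, if_pos (Finset.mem_univ _)]
      have := abs_le.1 (h6 a j)
      rw [min_eq_right this.2, max_eq_right this.1]
    rw [h9] at h8
    exact h8

/-! ### Measurability -/

theorem mul_meas {Ω : Type*} [MeasurableSpace Ω] {n m l : ℕ}
    {P : Ω → Matrix (Fin n) (Fin m) ℝ} {R : Ω → Matrix (Fin m) (Fin l) ℝ}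
    (hP : ∀ a b, Measurable fun ω => P ω a b) (hR : ∀ a b, Measurable fun ω => R ω a b)
    (a : Fin n) (c : Fin l) : Measurable fun ω => (P ω * R ω) a c := by
  simp only [Matrix.mul_apply]
  exact Finset.measurable_sum _ fun x _ => (hP a x).mul (hR x c)

theorem block_meas {Ω : Type*} [MeasurableSpace Ω] (Y : Ω → Mat N d)
    (hY : ∀ a j, Measurable fun ω => Y ω a j)
    (WQ WK WV : Fin 2 → Matrix (Fin d) (Fin 1) ℝ)
      (WO : Fin 2 → Matrix (Fin 1) (Fin d) ℝ)
      (W₁ : Matrix (Fin d) (Fin 4) ℝ) (b₁ : Fin 4 → ℝ)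
      (W₂ : Matrix (Fin 4) (Fin d) ℝ) (b₂ : Fin d → ℝ) (a : Fin N) (j : Fin d) :
    Measurable fun ω => kMIPBlock k WQ WK WV WO W₁ b₁ W₂ b₂ (Y ω) a j := by
  have hmul : ∀ {m : ℕ} (W : Matrix (Fin d) (Fin m) ℝ) a x, Measurable fun ω => (Y ω * W) a x :=
    fun W => mul_meas hY (fun _ _ => measurable_const)
  have hsc : ∀ h a b, Measurable fun ω => scores (WQ h) (WK h) (Y ω) a b :=
    fun h => mul_meas (hmul _) (fun a b => hmul (WK h) b a)
  have htop : ∀ h a b, MeasurableSet {ω | b ∈ topkSet k (scores (WQ h) (WK h) (Y ω) a)} := by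
    intro h a b
    simp only [topkSet, Finset.mem_filter, Finset.mem_univ, true_and, Finset.card_filter]
    refine measurableSet_lt (Finset.measurable_sum _ fun b' _ => ?_) measurable_const
    refine Measurable.ite ?_ measurable_const measurable_const
    refine (measurableSet_lt (hsc h a b) (hsc h a b')).union ?_
    exact (measurableSet_eq_fun (hsc h a b') (hsc h a b)).inter (MeasurableSet.const _)
  have hat : ∀ a j, Measurable fun ω => kMIPAttn k WQ WK WV WO (Y ω) a j := by
    intro a j
    simp only [kMIPAttn, Matrix.sum_apply]
    refine Finset.measurable_sum _ fun h _ =>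
      mul_meas (R := fun _ => WO h) (mul_meas (R := fun ω => Y ω * WV h) (fun a b => ?_) (hmul _))
        (fun _ _ => measurable_const) a j
    simp only [Matrix.of_apply]
    have hexp : ∀ b, Measurable fun ω =>
        Real.exp (scores (WQ h) (WK h) (Y ω) a b / Real.sqrt (1 : ℕ)) := fun b =>
      Real.measurable_exp.comp ((hsc h a b).div_const _)
    refine Measurable.div ?_ ?_
    · exact Measurable.ite (htop h a b) (hexp b) measurable_const
    · have : ∀ ω, ∑ j' ∈ topkSet k (scores (WQ h) (WK h) (Y ω) a),
          Real.exp (scores (WQ h) (WK h) (Y ω) a j' / Real.sqrt (1 : ℕ)) =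
          ∑ j', if j' ∈ topkSet k (scores (WQ h) (WK h) (Y ω) a) then
            Real.exp (scores (WQ h) (WK h) (Y ω) a j' / Real.sqrt (1 : ℕ)) else 0 := by
        intro ω
        rw [← Finset.sum_filter]; simp
      simp only [this]
      exact Finset.measurable_sum _ fun b _ => Measurable.ite (htop h a b) (hexp b) measurable_const
  have hZ : ∀ a j, Measurable fun ω => (Y ω + kMIPAttn k WQ WK WV WO (Y ω)) a j :=
    fun a j => (hY a j).add (hat a j)
  have hmax : ∀ a i, Measurable fun ω => (Matrix.of fun i j => max 0
      (((Y ω + kMIPAttn k WQ WK WV WO (Y ω)) * W₁) i j + b₁ j) : Matrix (Fin N) (Fin 4) ℝ) a i := by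
    intro a i
    simp only [Matrix.of_apply]
    exact measurable_const.max
      ((mul_meas (R := fun _ => W₁) hZ (fun _ _ => measurable_const) a i).add_const (b₁ i))
  exact (hZ a j).add ((mul_meas (R := fun _ => W₂) hmax (fun _ _ => measurable_const) a j).add_const (b₂ j))

theorem kMIP_meas {T : Mat N d → Mat N d} (h : IsKMIPTransformer N d k 2 1 4 T) :
    ∀ a j, Measurable fun X : Fin N → Fin d → ℝ => T X a j := by
  have hid : ∀ a j, Measurable fun X : Fin N → Fin d → ℝ => X a j := fun a j =>
    (measurable_pi_apply j).comp (measurable_pi_apply a)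
  induction h with
  | single WQ WK WV WO W₁ b₁ W₂ b₂ => exact block_meas (Ω := Fin N → Fin d → ℝ) (fun X => X) hid _ _ _ _ _ _ _ _
  | comp WQ WK WV WO W₁ b₁ W₂ b₂ hT ih => exact block_meas (Ω := Fin N → Fin d → ℝ) _ ih _ _ _ _ _ _ _ _

/-! ### Full transformers -/

theorem full_cont {H m r : ℕ} {T : Mat N d → Mat N d} (h : IsFullTransformer N d H m r T) :
    Continuous T := by
  have hb : ∀ (WQ WK WV : Fin H → Matrix (Fin d) (Fin m) ℝ)
      (WO : Fin H → Matrix (Fin m) (Fin d) ℝ)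
      (W₁ : Matrix (Fin d) (Fin r) ℝ) (b₁ : Fin r → ℝ)
      (W₂ : Matrix (Fin r) (Fin d) ℝ) (b₂ : Fin d → ℝ),
      Continuous fun X : Mat N d => fullBlock WQ WK WV WO W₁ b₁ W₂ b₂ X := by
    intro WQ WK WV WO W₁ b₁ W₂ b₂
    have h1 : Continuous fun X : Mat N d => fullAttn WQ WK WV WO X := by
      unfold fullAttn
      refine continuous_finsetSum _ fun h _ => ?_
      refine Continuous.matrix_mul (Continuous.matrix_mul ?_
        (continuous_id.matrix_mul continuous_const)) continuous_const
      have hs : Continuous fun X : Mat N d => scores (WQ h) (WK h) X := by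
        unfold scores
        exact (continuous_id.matrix_mul continuous_const).matrix_mul
          (continuous_id.matrix_mul continuous_const).matrix_transpose
      refine continuous_matrix fun i j => ?_
      simp only [softmaxRows, Matrix.of_apply]
      refine Continuous.div ?_ ?_ ?_
      · exact Real.continuous_exp.comp ((hs.matrix_elem i j).div_const _)
      · exact continuous_finsetSum _ fun j' _ =>
          Real.continuous_exp.comp ((hs.matrix_elem i j').div_const _)
      · intro X
        exact (Finset.sum_pos (fun _ _ => Real.exp_pos _) ⟨i, Finset.mem_univ _⟩).ne'
    have hz : Continuous fun X : Mat N d => X + fullAttn WQ WK WV WO X := continuous_id.add h1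
    unfold fullBlock mlp
    refine hz.add (Continuous.add (Continuous.matrix_mul ?_ continuous_const) continuous_const)
    refine continuous_matrix fun i j => ?_
    simp only [Matrix.of_apply]
    exact continuous_const.max (((hz.matrix_mul continuous_const).matrix_elem i j).add
      continuous_const)
  induction h with
  | single WQ WK WV WO W₁ b₁ W₂ b₂ => exact hb _ _ _ _ _ _ _ _
  | comp WQ WK WV WO W₁ b₁ W₂ b₂ hT ih => exact (hb _ _ _ _ _ _ _ _).comp ih

theorem mul_row {n l m : ℕ} (s : Fin n → Fin n) {P P' : Matrix (Fin n) (Fin m) ℝ}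
    (W : Matrix (Fin m) (Fin l) ℝ)
    (h : ∀ a j, P' a j = P (s a) j) (a : Fin n) (j : Fin l) : (P' * W) a j = (P * W) (s a) j := by
  simp only [Matrix.mul_apply, h]

theorem block_equiv {H m r : ℕ} (σ : Equiv.Perm (Fin N))
    (WQ WK WV : Fin H → Matrix (Fin d) (Fin m) ℝ)
      (WO : Fin H → Matrix (Fin m) (Fin d) ℝ)
      (W₁ : Matrix (Fin d) (Fin r) ℝ) (b₁ : Fin r → ℝ)
      (W₂ : Matrix (Fin r) (Fin d) ℝ) (b₂ : Fin d → ℝ) (X Y : Mat N d)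
      (hY : ∀ a j, Y a j = X (σ a) j) (a : Fin N) (j : Fin d) :
      fullBlock WQ WK WV WO W₁ b₁ W₂ b₂ Y a j = fullBlock WQ WK WV WO W₁ b₁ W₂ b₂ X (σ a) j := by
  have hs : ∀ h a b, scores (WQ h) (WK h) Y a b = scores (WQ h) (WK h) X (σ a) (σ b) := by
    intro h a b
    unfold scores
    rw [Matrix.mul_apply, Matrix.mul_apply]
    refine Finset.sum_congr rfl fun x _ => ?_
    rw [Matrix.transpose_apply, Matrix.transpose_apply, mul_row σ _ hY, mul_row σ _ hY]
  have hat : ∀ a j, fullAttn WQ WK WV WO Y a j = fullAttn WQ WK WV WO X (σ a) j := by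
    intro a j
    unfold fullAttn
    rw [Matrix.sum_apply, Matrix.sum_apply]
    refine Finset.sum_congr rfl fun h _ => mul_row σ _ (fun a x => ?_) a j
    rw [Matrix.mul_apply, Matrix.mul_apply, ← Equiv.sum_comp σ (fun b =>
      softmaxRows m (scores (WQ h) (WK h) X) (σ a) b * (X * WV h) b x)]
    refine Finset.sum_congr rfl fun b _ => ?_
    rw [mul_row σ _ hY]
    congr 1
    simp only [softmaxRows, Matrix.of_apply, hs]
    congr 1
    exact Equiv.sum_comp σ fun b => Real.exp (scores (WQ h) (WK h) X (σ a) b / Real.sqrt m)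
  have hZ : ∀ a j, (Y + fullAttn WQ WK WV WO Y) a j = (X + fullAttn WQ WK WV WO X) (σ a) j := by
    intro a j
    rw [Matrix.add_apply, Matrix.add_apply, hY, hat]
  unfold fullBlock mlp
  rw [Matrix.add_apply, Matrix.add_apply _ _ (σ a), hZ]
  congr 1
  rw [Matrix.add_apply, Matrix.add_apply _ _ (σ a)]
  congr 1
  refine mul_row σ _ (fun a x => ?_) a j
  rw [Matrix.of_apply, Matrix.of_apply, mul_row σ _ hZ]

theorem full_equiv {H m r : ℕ} {T : Mat N d → Mat N d} (h : IsFullTransformer N d H m r T)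
    (σ : Equiv.Perm (Fin N)) (X : Mat N d) : T (fun a => X (σ a)) = fun a => T X (σ a) := by
  have key : ∀ X Y : Mat N d, (∀ a j, Y a j = X (σ a) j) → ∀ a j, T Y a j = T X (σ a) j := by
    induction h with
    | single WQ WK WV WO W₁ b₁ W₂ b₂ => exact block_equiv σ _ _ _ _ _ _ _ _
    | comp WQ WK WV WO W₁ b₁ W₂ b₂ hT ih =>
      intro X Y hY
      exact block_equiv σ _ _ _ _ _ _ _ _ _ _ (ih X Y hY)
  funext a j
  exact key X _ (fun _ _ => rfl) a j

/-! ### Measure-theoretic assembly -/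

open scoped ENNReal in
theorem diag_lint {α : Type*} [MeasurableSpace α] (μ : Measure α) [IsFiniteMeasure μ]
    (D : ℕ → ℕ → α → ℝ≥0∞) (hD : ∀ q n, Measurable (D q n)) (C : ℝ≥0∞) (hC : C ≠ ∞)
    (hb : ∀ q n, ∀ᵐ x ∂μ, D q n x ≤ C) (L : ℕ → α → ℝ≥0∞)
    (hL : ∀ᵐ x ∂μ, ∀ᶠ q in atTop, Tendsto (fun n => D q n x) atTop (𝓝 (L q x)))
    (h0 : ∀ᵐ x ∂μ, Tendsto (fun q => L q x) atTop (𝓝 0)) {δ : ℝ≥0∞} (hδ : 0 < δ) :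
    ∃ q n, ∫⁻ x, D q n x ∂μ < δ := by
  have hfin : ∫⁻ _, C ∂μ ≠ ∞ := by
    rw [lintegral_const]
    exact ENNReal.mul_ne_top hC (measure_ne_top _ _)
  have hb' : ∀ᵐ x ∂μ, ∀ q n, D q n x ≤ C := ae_all_iff.2 fun q => ae_all_iff.2 fun n => hb q n
  have h1 : Tendsto (fun q => ∫⁻ x, limsup (fun n => D q n x) atTop ∂μ) atTop
      (𝓝 (∫⁻ _, 0 ∂μ)) := by
    refine tendsto_lintegral_of_dominated_convergence (fun _ => C)
      (fun q => Measurable.limsup (hD q)) (fun q => ?_) hfin ?_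
    · filter_upwards [hb'] with x hx
      exact limsup_le_of_le (by isBoundedDefault) (Eventually.of_forall fun n => hx q n)
    · filter_upwards [hL, h0] with x hx hx0
      refine hx0.congr' ?_
      filter_upwards [hx] with q hq
      exact hq.limsup_eq.symm
  rw [lintegral_zero] at h1
  obtain ⟨q, hq⟩ := (h1.eventually (eventually_lt_nhds hδ)).exists
  have h2 := (limsup_lintegral_le (μ := μ) (f := D q) (fun _ => C) (hD q)
    (fun n => hb q n) hfin).trans_lt hq
  obtain ⟨n, hn⟩ := (eventually_lt_of_limsup_lt h2).exists
  exact ⟨q, n, hn⟩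

theorem ae_gd : ∀ᵐ X : Fin N → Fin d → ℝ, ∀ q : ℕ, X ∈ Gd (N := N) (d := d) ((q : ℝ) + 1) := by
  refine ae_all_iff.2 fun q => ?_
  have : ∀ᵐ X : Fin N → Fin d → ℝ, ∀ a j, ∀ z : ℤ, X a j * ((q : ℝ) + 1) ≠ z := by
    refine ae_all_iff.2 fun a => ae_all_iff.2 fun j => ae_all_iff.2 fun z => ?_
    have h1 : ∀ᵐ t : ℝ, t * ((q : ℝ) + 1) ≠ z := by
      have : ∀ᵐ t : ℝ, t ≠ z / ((q : ℝ) + 1) := Measure.ae_ne volume _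
      filter_upwards [this] with t ht h
      apply ht
      have : (q : ℝ) + 1 ≠ 0 := by positivity
      field_simp
      exact h
    have h2 : ∀ᵐ x : Fin d → ℝ, x j * ((q : ℝ) + 1) ≠ z :=
      (Measure.quasiMeasurePreserving_eval (fun _ : Fin d => (volume : Measure ℝ)) j).ae h1
    exact (Measure.quasiMeasurePreserving_eval
      (fun _ : Fin N => (volume : Measure (Fin d → ℝ))) a).ae h2
  exact this

theorem ae_inj (j0 : Fin d) : ∀ᵐ X : Fin N → Fin d → ℝ, ∀ a b, a ≠ b → X a j0 ≠ X b j0 := by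
  classical
  refine ae_all_iff.2 fun a => ae_all_iff.2 fun b => ?_
  by_cases hab : a = b
  · exact Eventually.of_forall fun X h => absurd hab h
  let l : (Fin N → Fin d → ℝ) →ₗ[ℝ] ℝ :=
    { toFun := fun X => X a j0 - X b j0
      map_add' := fun X Y => by simp only [Pi.add_apply]; ring
      map_smul' := fun c X => by simp only [Pi.smul_apply, smul_eq_mul, RingHom.id_apply]; ring }
  have hl : LinearMap.ker l ≠ ⊤ := by
    intro h
    have h1 : (Pi.single a (Pi.single j0 1) : Fin N → Fin d → ℝ) ∈ LinearMap.ker l := h ▸ trivial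
    rw [LinearMap.mem_ker] at h1
    simp [l, Ne.symm hab] at h1
  have h2 := Measure.addHaar_submodule (volume : Measure (Fin N → Fin d → ℝ)) _ hl
  have h3 : ∀ᵐ X : Fin N → Fin d → ℝ, X ∉ (LinearMap.ker l : Set (Fin N → Fin d → ℝ)) :=
    measure_eq_zero_iff_ae_notMem.1 h2
  filter_upwards [h3] with X hX _ h
  apply hX
  change X a j0 - X b j0 = 0
  linarith

theorem quant_sub {Q : ℝ} (hQ : 0 < Q) (t : ℝ) : |quant Q t - t| ≤ 1 / Q := by
  have h1 := quant_mul hQ t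
  have h2 := Int.floor_le (t * Q)
  have h3 := Int.lt_floor_add_one (t * Q)
  rw [le_div_iff₀ hQ]
  have : |quant Q t - t| * Q = |(quant Q t - t) * Q| := by rw [abs_mul, abs_of_pos hQ]
  rw [this, sub_mul, h1, abs_le]
  constructor <;> linarith

theorem quant_lim (t : ℝ) : Tendsto (fun q : ℕ => quant ((q : ℝ) + 1) t) atTop (𝓝 t) := by
  rw [tendsto_iff_norm_sub_tendsto_zero]
  refine squeeze_zero (fun _ => norm_nonneg _) (fun q => ?_)
    (tendsto_one_div_add_atTop_nhds_zero_nat (𝕜 := ℝ))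
  exact quant_sub (by positivity) t

theorem final {H m r : ℕ} (hN : 1 ≤ N) (hd : 1 ≤ d) (hk1 : 1 ≤ k) (f : Mat N d → Mat N d)
    (hfull : IsFullTransformer N d H m r f) (ε : ℝ) (hε : 0 < ε) (p : ℝ) (hp : 1 ≤ p)
    (U : Set (Fin N → Fin d → ℝ)) (hU : IsCompact U) :
    ∃ T : Mat N d → Mat N d, IsKMIPTransformer N d k 2 1 4 T ∧
      (∫ X in U, ∑ i : Fin N, ∑ j : Fin d, |T X i j - f X i j| ^ p
          ∂(volume : Measure (Fin N → Fin d → ℝ))) ^ (1 / p) < ε := by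
  have hp0 : 0 < p := by linarith
  have fc : Continuous f := full_cont hfull
  have fce : ∀ i j, Continuous fun X : Fin N → Fin d → ℝ => f X i j := fun i j =>
    (continuous_apply j).comp ((continuous_apply i).comp fc)
  -- the bound on `U`
  obtain ⟨B, hB⟩ : ∃ B : ℝ, ∀ X ∈ U, ∀ a j, |X a j| ≤ B := by
    obtain ⟨B, hB⟩ := hU.exists_bound_of_continuousOn (f := fun X => X) continuousOn_id
    exact ⟨B, fun X hX a j => ((norm_le_pi_norm (X a) j).trans (norm_le_pi_norm X a)).trans (hB X hX)⟩
  obtain ⟨M, hM0, hM⟩ : ∃ M : ℝ, 0 ≤ M ∧ ∀ X : Fin N → Fin d → ℝ, (∀ a j, |X a j| ≤ B + 1) →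
      ∀ a j, |f X a j| ≤ M := by
    let K : Set (Fin N → Fin d → ℝ) :=
      Set.pi Set.univ fun _ => Set.pi Set.univ fun _ => Set.Icc (-(B + 1)) (B + 1)
    have hK : IsCompact K := isCompact_univ_pi fun _ => isCompact_univ_pi fun _ => isCompact_Icc
    obtain ⟨M, hM⟩ := hK.exists_bound_of_continuousOn (f := fun X => ∑ a, ∑ j, |f X a j|)
      (continuous_finsetSum _ fun a _ => continuous_finsetSum _ fun j _ =>
        (fce a j).abs).continuousOn
    refine ⟨|M|, abs_nonneg _, fun X hX a j => ?_⟩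
    have h1 := hM X (fun a _ j _ => abs_le.1 (hX a j))
    have h2 : |f X a j| ≤ ∑ j, |f X a j| :=
      Finset.single_le_sum (f := fun j => |f X a j|) (fun _ _ => abs_nonneg _) (Finset.mem_univ j)
    have h3 : ∑ j, |f X a j| ≤ ∑ a, ∑ j, |f X a j| :=
      Finset.single_le_sum (f := fun a => ∑ j, |f X a j|)
        (fun _ _ => Finset.sum_nonneg fun _ _ => abs_nonneg _) (Finset.mem_univ a)
    exact (h2.trans h3).trans ((le_abs_self _).trans (h1.trans (le_abs_self _)))
  have hq0 : ∀ q : ℕ, (0 : ℝ) < (q : ℝ) + 1 := fun q => by positivity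
  choose T hT hTM hTl using fun q : ℕ =>
    main_appr (k := k) hd hk1 hN f (full_equiv hfull) (hq0 q) B M hM0
  have : IsFiniteMeasure ((volume : Measure (Fin N → Fin d → ℝ)).restrict U) :=
    ⟨by rw [Measure.restrict_apply_univ]; exact hU.measure_lt_top⟩
  let g : Mat N d → (Fin N → Fin d → ℝ) → ℝ := fun Y X => ∑ i, ∑ j, |Y i j - f X i j| ^ p
  have hg0 : ∀ Y X, 0 ≤ g Y X := fun Y X =>
    Finset.sum_nonneg fun _ _ => Finset.sum_nonneg fun _ _ => Real.rpow_nonneg (abs_nonneg _) _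
  have hgc : ∀ X, Continuous fun Y : Mat N d => g Y X := by
    intro X
    refine continuous_finsetSum _ fun i _ => continuous_finsetSum _ fun j _ => ?_
    have h1 : Continuous fun Y : Mat N d => Y i j :=
      (continuous_apply j).comp (continuous_apply i)
    exact (h1.sub continuous_const).abs.rpow_const fun _ => Or.inr hp0.le
  have hgm : ∀ q n, Measurable fun X : Fin N → Fin d → ℝ => g (T q n X) X := by
    intro q n
    refine Finset.measurable_sum _ fun i _ => Finset.measurable_sum _ fun j _ => ?_
    exact ((kMIP_meas (hT q n) i j).sub (fce i j).measurable).abs.pow_const p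
  have haeU : ∀ᵐ X ∂((volume : Measure (Fin N → Fin d → ℝ)).restrict U), X ∈ U :=
    ae_restrict_mem hU.measurableSet
  obtain ⟨q, n, hqn⟩ := diag_lint ((volume : Measure (Fin N → Fin d → ℝ)).restrict U)
    (fun q n X => ENNReal.ofReal (g (T q n X) X)) (fun q n => (hgm q n).ennreal_ofReal)
    (ENNReal.ofReal (∑ _ : Fin N, ∑ _ : Fin d, (2 * M) ^ p)) ENNReal.ofReal_ne_top
    (by
      intro q n
      filter_upwards [haeU] with X hX
      refine ENNReal.ofReal_le_ofReal (Finset.sum_le_sum fun i _ => Finset.sum_le_sum fun j _ => ?_)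
      refine Real.rpow_le_rpow (abs_nonneg _) ?_ hp0.le
      have h1 := hTM q n X i j
      have h2 := hM X (fun a j => (hB X hX a j).trans (by linarith)) i j
      have h3 := abs_sub (T q n X i j) (f X i j)
      linarith)
    (fun q X => ENNReal.ofReal (g (f (fun a j => quant ((q : ℝ) + 1) (X a j))) X))
    (by
      filter_upwards [haeU, ae_restrict_of_ae (ae_gd (N := N) (d := d)),
        ae_restrict_of_ae (ae_inj (N := N) (⟨0, hd⟩ : Fin d))] with X hX hgd hinj
      have hev : ∀ᶠ q : ℕ in atTop, ∀ a b, a ≠ b →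
          quant ((q : ℝ) + 1) (X a ⟨0, hd⟩) ≠ quant ((q : ℝ) + 1) (X b ⟨0, hd⟩) := by
        refine eventually_all.2 fun a => eventually_all.2 fun b => ?_
        by_cases hab : a = b
        · exact Eventually.of_forall fun q h => absurd hab h
        · exact (((quant_lim (X a ⟨0, hd⟩)).sub (quant_lim (X b ⟨0, hd⟩))).eventually_ne
            (sub_ne_zero.2 (hinj a b hab))).mono fun q h _ => sub_ne_zero.1 h
      filter_upwards [hev] with q hq
      refine (ENNReal.continuous_ofReal.tendsto _).comp (((hgc X).tendsto _).comp
        (hTl q X (hgd q) (hB X hX) ?_ ?_))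
      · intro a b hab
        by_contra hne
        exact hq a b hne (congrFun hab ⟨0, hd⟩)
      · refine hM _ fun a j => ?_
        have h1 := quant_sub (hq0 q) (X a j)
        have h2 : 1 / ((q : ℝ) + 1) ≤ 1 := by
          rw [div_le_one (hq0 q)]; linarith [(Nat.cast_nonneg q : (0 : ℝ) ≤ q)]
        have h3 := hB X hX a j
        have h4 := abs_le.1 h1
        have h5 := abs_le.1 h3
        rw [abs_le]
        constructor <;> linarith)
    (by
      refine Eventually.of_forall fun X => ?_
      have h1 : Tendsto (fun q : ℕ => (fun a j => quant ((q : ℝ) + 1) (X a j) : Mat N d)) atTop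
          (𝓝 X) := tendsto_pi_nhds.2 fun a => tendsto_pi_nhds.2 fun j => quant_lim _
      have h2 := (((ENNReal.continuous_ofReal.comp (hgc X)).comp fc).tendsto X).comp h1
      have h3 : g (f X) X = 0 := by simp [g, Real.zero_rpow hp0.ne']
      have h4 : ENNReal.ofReal (g (f X) X) = 0 := by rw [h3, ENNReal.ofReal_zero]
      exact h4 ▸ h2)
    (δ := ENNReal.ofReal (ε ^ p)) (ENNReal.ofReal_pos.2 (Real.rpow_pos_of_pos hε p))
  refine ⟨T q n, hT q n, ?_⟩
  change (∫ X in U, g (T q n X) X ∂(volume : Measure (Fin N → Fin d → ℝ))) ^ (1 / p) < ε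
  have hlt : ∫ X in U, g (T q n X) X ∂(volume : Measure (Fin N → Fin d → ℝ)) < ε ^ p := by
    rw [integral_eq_lintegral_of_nonneg_ae (Eventually.of_forall fun X => hg0 _ _)
      (hgm q n).aestronglyMeasurable]
    rw [← ENNReal.toReal_ofReal (Real.rpow_nonneg hε.le p)]
    exact ENNReal.toReal_strict_mono ENNReal.ofReal_ne_top hqn
  have h1 := Real.rpow_lt_rpow (integral_nonneg fun X => hg0 _ _) hlt
    (show (0 : ℝ) < 1 / p by positivity)
  rwa [← Real.rpow_mul hε.le, mul_one_div_cancel hp0.ne', Real.rpow_one] at h1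

end KMIP

/-- **k-MIP Approximation Theorem.** Every full-attention transformer
`T_full ∈ 𝒯_full^{H,m,r}` can be approximated to arbitrary precision `ε`, in the
`Lᵖ(U)` sense (entrywise `ℓᵖ` norm, Lebesgue measure) on any compact set `U`, by
a k-MIP transformer `T_kMIP ∈ 𝒯_{k-MIP}^{2,1,4}`. -/
theorem kMIP_approximation {N d H m r : ℕ}
    (hN : 1 ≤ N) (hd : 1 ≤ d) (hH : 1 ≤ H) (hm : 1 ≤ m) (hr : 1 ≤ r)
    (k : ℕ) (hk1 : 1 ≤ k) (hkN : k ≤ N)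
    (Tfull : Matrix (Fin N) (Fin d) ℝ → Matrix (Fin N) (Fin d) ℝ)
    (hTfull : IsFullTransformer N d H m r Tfull)
    (ε : ℝ) (hε : 0 < ε) (p : ℝ) (hp : 1 ≤ p)
    (U : Set (Matrix (Fin N) (Fin d) ℝ)) (hU : IsCompact U) :
    ∃ TkMIP : Matrix (Fin N) (Fin d) ℝ → Matrix (Fin N) (Fin d) ℝ,
      IsKMIPTransformer N d k 2 1 4 TkMIP ∧
      (∫ X in U, ∑ i : Fin N, ∑ j : Fin d, |TkMIP X i j - Tfull X i j| ^ p
          ∂(volume : Measure (Fin N → Fin d → ℝ))) ^ (1 / p) < ε := by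
  exact KMIP.final hN hd hk1 Tfull hTfull ε hε p hp U hU
end
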